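/- Under the stated assumptions (conditional independence of the A-increments given the chain, and superlinear growth of the conjugates φ^{xy*}_{|·|}), the sequence of random pairs (K^n, Θ^n) satisfies the large-deviation principle in (ℝ^d)^{𝒳×𝒳} × 𝒫(𝒳×𝒳) with speed n and good rate functional I: that is, I is lower semicontinuous with compact sublevel sets, limsup_{n→∞} (1/n) log ℙ((K^n,Θ^n) ∈ F) ≤ −inf_{(k,θ)∈F} I(k,θ) for every closed set F, and liminf_{n→∞} (1/n) log ℙ((K^n,Θ^n) ∈ G) ≥ −inf_{(k,θ)∈G} I(k,θ) for every open set G. -/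

import Mathlib

open MeasureTheory ProbabilityTheory Filter
open scoped ENNReal Classical

noncomputable section

/-- The ℓ¹-norm on `ℝ^d`. -/
def l1norm {d : ℕ} (a : Fin d → ℝ) : ℝ := ∑ i, |a i|

/-- Euclidean dot product on `ℝ^d`. -/
def dotp {d : ℕ} (l a : Fin d → ℝ) : ℝ := ∑ i, l i * a i

/-- The logarithmic moment generating function `φ(λ) = log ∫ e^{λ·a} q(da) ∈ (-∞,∞]`. -/
def logMGF {d : ℕ} (q : Measure (Fin d → ℝ)) (l : Fin d → ℝ) : EReal :=
  ENNReal.log (∫⁻ a, ENNReal.ofReal (Real.exp (dotp l a)) ∂q)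

/-- Legendre transform `φ*(a) = sup_λ [λ·a - φ(λ)]`. -/
def cramerTransform {d : ℕ} (q : Measure (Fin d → ℝ)) (a : Fin d → ℝ) : EReal :=
  ⨆ l : Fin d → ℝ, ((dotp l a : ℝ) : EReal) - logMGF q l

/-- `φ_{|·|}(s) = log ∫ e^{s|a|₁} q(da)`. -/
def logMGFAbs {d : ℕ} (q : Measure (Fin d → ℝ)) (s : ℝ) : EReal :=
  ENNReal.log (∫⁻ a, ENNReal.ofReal (Real.exp (s * l1norm a)) ∂q)

/-- `φ*_{|·|}(r) = sup_s [rs - φ_{|·|}(s)]`. -/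
def cramerTransformAbs {d : ℕ} (q : Measure (Fin d → ℝ)) (r : ℝ) : EReal :=
  ⨆ s : ℝ, ((r * s : ℝ) : EReal) - logMGFAbs q s

/-- Superlinear growth: `liminf_{r→∞} φ*_{|·|}(r)/r = ∞`. -/
def Superlinear {d : ℕ} (q : Measure (Fin d → ℝ)) : Prop :=
  Filter.liminf (fun r : ℝ => cramerTransformAbs q r / (r : EReal)) Filter.atTop = ⊤

/-- The Boltzmann function `s(a|b)`. -/
def sEnt (a b : ℝ) : EReal :=
  if 0 < a ∧ 0 < b then ((a * Real.log (a / b) - a + b : ℝ) : EReal)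
  else if a = 0 ∧ 0 ≤ b then ((b : ℝ) : EReal)
  else ⊤

/-- Empirical pair/increment average `K^n`. -/
def Kn {Ω 𝒳 : Type*} {d : ℕ} (X : ℕ → Ω → 𝒳) (A : ℕ → Ω → (Fin d → ℝ)) (n : ℕ) (ω : Ω) :
    𝒳 × 𝒳 → (Fin d → ℝ) := fun p =>
  (1 / (n : ℝ)) • ∑ m ∈ Finset.Icc 1 n, if (X (m - 1) ω, X m ω) = p then A m ω else 0

/-- Pair-empirical measure `Θ^n`. -/
def Thetan {Ω 𝒳 : Type*} (X : ℕ → Ω → 𝒳) (n : ℕ) (ω : Ω) : 𝒳 × 𝒳 → ℝ := fun p =>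
  (1 / (n : ℝ)) * ∑ m ∈ Finset.Icc 1 n, if (X (m - 1) ω, X m ω) = p then 1 else 0

/-- `θ ∈ 𝒫_n(𝒳×𝒳)`: a probability vector all of whose entries are positive multiples of `1/n`. -/
def memPn {𝒳 : Type*} [Fintype 𝒳] (n : ℕ) (θ : 𝒳 × 𝒳 → ℝ) : Prop :=
  θ ∈ stdSimplex ℝ (𝒳 × 𝒳) ∧ ∀ p : 𝒳 × 𝒳, ∃ c : ℕ, 1 ≤ c ∧ (c : ℝ) = n * θ p

/-- The rate functional `I(k,θ)` of Theorem 1 (extended by `∞` off the probability simplex). -/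
def rateI {𝒳 : Type*} [Fintype 𝒳] {d : ℕ} (P : 𝒳 → 𝒳 → ℝ)
    (q : 𝒳 → 𝒳 → Measure (Fin d → ℝ)) (k : 𝒳 × 𝒳 → (Fin d → ℝ)) (θ : 𝒳 × 𝒳 → ℝ) : EReal :=
  if (∀ p : 𝒳 × 𝒳, θ p = 0 → k p = 0) ∧ (∀ x : 𝒳, ∑ y, θ (x, y) = ∑ y, θ (y, x)) ∧
      θ ∈ stdSimplex ℝ (𝒳 × 𝒳) then
    (∑ p : 𝒳 × 𝒳, ((θ p : ℝ) : EReal) * cramerTransform (q p.1 p.2) ((θ p)⁻¹ • k p)) +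
      ∑ p : 𝒳 × 𝒳, sEnt (θ p) ((∑ y, θ (p.1, y)) * P p.1 p.2)
  else ⊤

/-- The `n`-step kernel of a Markov additive process on `S` with one-step kernel `R`: the
mass that `stepPow R n a b` gives to `B` is that of the paths of length `n` from `a` to `b` whose
increments sum to an element of `B`. -/
def stepPow {S E : Type*} [Fintype S] [DecidableEq S] [AddMonoid E] [MeasurableSpace E]
    (R : S → S → Measure E) : ℕ → S → S → Measure E
  | 0 => fun a b => if a = b then Measure.dirac 0 else 0
  | n + 1 => fun a b => ∑ c, Measure.conv (stepPow R n a c) (R c b)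

section StepPow

variable {S E : Type*} [Fintype S] [DecidableEq S] [AddMonoid E] [MeasurableSpace E]
  (R : S → S → Measure E)

theorem stepPow_succ (n : ℕ) (a b : S) :
    stepPow R (n + 1) a b = ∑ c, Measure.conv (stepPow R n a c) (R c b) := rfl

instance stepPow_isFiniteMeasure [∀ a b, IsFiniteMeasure (R a b)] (n : ℕ) (a b : S) :
    IsFiniteMeasure (stepPow R n a b) := by
  induction n generalizing a b with
  | zero =>
    simp only [stepPow]
    split_ifs <;> infer_instance
  | succ n ih =>
    rw [stepPow_succ]
    infer_instance

variable [MeasurableAdd₂ E]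

theorem Measure_conv_finsetSum {ι : Type*} (s : Finset ι) (μ : Measure E) [SFinite μ]
    (ν : ι → Measure E) [∀ i, IsFiniteMeasure (ν i)] :
    Measure.conv μ (∑ i ∈ s, ν i) = ∑ i ∈ s, Measure.conv μ (ν i) := by
  induction s using Finset.induction_on with
  | empty => simp
  | insert i s hi ih => rw [Finset.sum_insert hi, Finset.sum_insert hi, Measure.conv_add, ih]

theorem conv_stepPow_le [∀ a b, IsFiniteMeasure (R a b)] (n m : ℕ) (a b c : S) :
    Measure.conv (stepPow R n a c) (stepPow R m c b) ≤ stepPow R (n + m) a b := by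
  induction m generalizing b with
  | zero =>
    simp only [stepPow, add_zero]
    split_ifs with h
    · subst h; simp
    · simpa using Measure.zero_le _
  | succ m ih =>
    rw [← add_assoc, stepPow_succ, stepPow_succ, Measure_conv_finsetSum]
    refine Finset.sum_le_sum fun e _ => ?_
    rw [← Measure.conv_assoc]
    exact Measure.map_mono (Measure.prod_mono (ih e) le_rfl) measurable_add

theorem lintegral_stepPow_succ [∀ a b, IsFiniteMeasure (R a b)] (n : ℕ) (a b : S)
    {F : E → ℝ≥0∞} (hF : Measurable F) :
    ∫⁻ s, F s ∂(stepPow R (n + 1) a b) =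
      ∑ c, ∫⁻ s, ∫⁻ t, F (s + t) ∂(R c b) ∂(stepPow R n a c) := by
  rw [stepPow_succ, lintegral_finsetSum_measure]
  exact Finset.sum_congr rfl fun c _ => Measure.lintegral_conv hF

theorem lintegral_stepPow [∀ a b, IsFiniteMeasure (R a b)] (n : ℕ) (a b : S)
    {F : E → ℝ≥0∞} (hF : Measurable F) (h0 : F 0 = 1) (hadd : ∀ s t, F (s + t) = F s * F t) :
    ∫⁻ s, F s ∂(stepPow R n a b) =
      ((Matrix.of fun a b => ∫⁻ s, F s ∂(R a b)) ^ n : Matrix S S ℝ≥0∞) a b := by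
  induction n generalizing b with
  | zero =>
    by_cases h : a = b
    · subst h; simp [stepPow, lintegral_dirac' _ hF, h0]
    · simp [stepPow, h]
  | succ n ih =>
    rw [lintegral_stepPow_succ R n a b hF, pow_succ, Matrix.mul_apply]
    refine Finset.sum_congr rfl fun c _ => ?_
    simp_rw [hadd, lintegral_const_mul _ hF]
    rw [lintegral_mul_const _ hF, ih]
    rfl

theorem lintegral_stepPow_le [∀ a b, IsFiniteMeasure (R a b)] (n : ℕ) (a b : S)
    {F : E → ℝ≥0∞} (hF : Measurable F) (h0 : F 0 ≤ 1) (hadd : ∀ s t, F (s + t) ≤ F s * F t)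
    {C : ℝ≥0∞} (hC : ∀ a b, ∫⁻ s, F s ∂(R a b) ≤ C) :
    ∫⁻ s, F s ∂(stepPow R n a b) ≤ (Fintype.card S * C) ^ n := by
  induction n generalizing b with
  | zero =>
    by_cases h : a = b
    · subst h; simpa [stepPow, lintegral_dirac' _ hF] using h0
    · simp [stepPow, h]
  | succ n ih =>
    rw [lintegral_stepPow_succ R n a b hF]
    calc _ ≤ ∑ c : S, (Fintype.card S * C) ^ n * C := by
          refine Finset.sum_le_sum fun c _ => ?_
          calc _ ≤ ∫⁻ s, ∫⁻ t, F s * F t ∂(R c b) ∂(stepPow R n a c) :=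
                lintegral_mono fun s => lintegral_mono fun t => hadd s t
            _ = (∫⁻ s, F s ∂(stepPow R n a c)) * ∫⁻ t, F t ∂(R c b) := by
                simp_rw [lintegral_const_mul _ hF]
                rw [lintegral_mul_const _ hF]
            _ ≤ _ := mul_le_mul' (ih c) (hC c b)
      _ = _ := by
          rw [Finset.sum_const, Finset.card_univ, nsmul_eq_mul, pow_succ]; ring

end StepPow

theorem ofReal_exp_add (s t : ℝ) : ENNReal.ofReal (Real.exp (s + t)) =
    ENNReal.ofReal (Real.exp s) * ENNReal.ofReal (Real.exp t) := by
  rw [Real.exp_add, ENNReal.ofReal_mul (Real.exp_pos _).le]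

theorem ofReal_exp_nsmul (n : ℕ) (s : ℝ) : ENNReal.ofReal (Real.exp (n * s)) =
    ENNReal.ofReal (Real.exp s) ^ n := by
  rw [Real.exp_nat_mul, ENNReal.ofReal_pow (Real.exp_pos _).le]

theorem ofReal_exp_mono {s t : ℝ} (h : s ≤ t) :
    ENNReal.ofReal (Real.exp s) ≤ ENNReal.ofReal (Real.exp t) :=
  ENNReal.ofReal_le_ofReal (Real.exp_le_exp.2 h)

theorem ofReal_exp_ne_zero (s : ℝ) : ENNReal.ofReal (Real.exp s) ≠ 0 := by
  simpa using Real.exp_pos s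

theorem IsClosed.convex_of_natCast_div {V : Type*} [AddCommGroup V] [Module ℝ V]
    [TopologicalSpace V] [ContinuousAdd V] [ContinuousSMul ℝ V] {D : Set V} (hD : IsClosed D)
    (h : ∀ x ∈ D, ∀ y ∈ D, ∀ p q : ℕ, 0 < p + q →
      ((p : ℝ) / (p + q : ℕ)) • x + ((q : ℝ) / (p + q : ℕ)) • y ∈ D) : Convex ℝ D := by
  intro x hx y hy a b ha hb hab
  have hb' : b = 1 - a := by linarith
  subst hb'
  have hlim : Tendsto (fun n : ℕ => ((⌊a * (n : ℝ)⌋₊ : ℝ) / n)) atTop (nhds a) :=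
    (tendsto_nat_floor_mul_div_atTop ha).comp tendsto_natCast_atTop_atTop
  have hlim2 : Tendsto (fun n : ℕ => ((⌊a * (n : ℝ)⌋₊ : ℝ) / n) • x +
      (1 - ((⌊a * (n : ℝ)⌋₊ : ℝ) / n)) • y) atTop (nhds (a • x + (1 - a) • y)) :=
    (hlim.smul_const x).add ((tendsto_const_nhds.sub hlim).smul_const y)
  refine hD.mem_of_tendsto hlim2 ?_
  filter_upwards [eventually_gt_atTop 0] with n hn
  have hle : ⌊a * (n : ℝ)⌋₊ ≤ n := by
    refine Nat.floor_le_of_le ?_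
    nlinarith [(Nat.cast_nonneg n : (0 : ℝ) ≤ n)]
  obtain ⟨q, hq⟩ := Nat.exists_eq_add_of_le hle
  have hn' : (n : ℝ) ≠ 0 := by positivity
  have := h x hx y hy ⌊a * (n : ℝ)⌋₊ q (by omega)
  rw [← hq] at this
  convert this using 3
  have : (n : ℝ) = ⌊a * (n : ℝ)⌋₊ + q := by exact_mod_cast hq
  field_simp
  linarith

section Epigraph

variable {S E : Type*} [Fintype S] [DecidableEq S] [NormedAddCommGroup E] [NormedSpace ℝ E]
  [MeasurableSpace E]

/-- The closed epigraph of the exponential decay rate of the `n`-step loop measures at `o`: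
`(y, r)` belongs to it when near `y` the rescaled loop measures are at least `exp (-n r)` up to an
arbitrarily small error, for some `n ≥ 1`. -/
def loopEpigraph (R : S → S → Measure E) (o : S) : Set (E × ℝ) :=
  {p | ∀ ε > 0, ∃ n : ℕ, 1 ≤ n ∧ ENNReal.ofReal (Real.exp (-(n * (p.2 + ε)))) ≤
    stepPow R n o o (Metric.ball ((n : ℝ) • p.1) (n * ε))}

theorem isClosed_loopEpigraph (R : S → S → Measure E) (o : S) :
    IsClosed (loopEpigraph R o) := by
  rw [← closure_subset_iff_isClosed]
  intro p hp ε hε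
  obtain ⟨p', hp', hd⟩ := Metric.mem_closure_iff.1 hp (ε / 2) (by positivity)
  obtain ⟨n, hn, h⟩ := hp' (ε / 2) (by positivity)
  rw [Prod.dist_eq, max_lt_iff] at hd
  refine ⟨n, hn, le_trans (ofReal_exp_mono ?_) (h.trans (measure_mono ?_))⟩
  · have := (abs_lt.1 (Real.dist_eq p.2 p'.2 ▸ hd.2)).1
    have hn0 : (0 : ℝ) ≤ n := Nat.cast_nonneg n
    nlinarith
  · refine Metric.ball_subset_ball' ?_
    rw [dist_smul₀, dist_comm p'.1, Real.norm_natCast]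
    have hn0 : (0 : ℝ) ≤ n := Nat.cast_nonneg n
    nlinarith [hd.1]

theorem nonneg_of_mem_loopEpigraph {R : S → S → Measure E} {o : S}
    (hmass : ∀ n, stepPow R n o o Set.univ ≤ 1) {p : E × ℝ} (hp : p ∈ loopEpigraph R o) :
    0 ≤ p.2 := by
  by_contra! hneg
  obtain ⟨n, hn, h⟩ := hp (-p.2 / 2) (by linarith)
  have h1 := (h.trans (measure_mono (Set.subset_univ _))).trans (hmass n)
  rw [ENNReal.ofReal_le_one, Real.exp_le_one_iff] at h1
  have : (1 : ℝ) ≤ n := by exact_mod_cast hn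
  nlinarith

theorem mem_loopEpigraph_mono {R : S → S → Measure E} {o : S} {y : E} {r r' : ℝ}
    (h : (y, r) ∈ loopEpigraph R o) (hr : r ≤ r') : (y, r') ∈ loopEpigraph R o := by
  intro ε hε
  obtain ⟨n, hn, h⟩ := h ε hε
  refine ⟨n, hn, le_trans (ofReal_exp_mono ?_) h⟩
  have hn0 : (0 : ℝ) ≤ n := Nat.cast_nonneg n
  simp only
  nlinarith

variable [BorelSpace E] [FiniteDimensional ℝ E]

theorem stepPow_ball_mul_le (R : S → S → Measure E) [∀ a b, IsFiniteMeasure (R a b)]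
    (n m : ℕ) (a b c : S) (s t : E) (ρ σ : ℝ) :
    stepPow R n a c (Metric.ball s ρ) * stepPow R m c b (Metric.ball t σ) ≤
      stepPow R (n + m) a b (Metric.ball (s + t) (ρ + σ)) := by
  have : SecondCountableTopology E := by
    have := FiniteDimensional.proper_real E
    infer_instance
  refine le_trans ?_ (conv_stepPow_le R n m a b c _)
  rw [Measure.conv, Measure.map_apply measurable_add Metric.isOpen_ball.measurableSet,
    ← Measure.prod_prod]
  refine measure_mono ?_
  rintro ⟨u, v⟩ ⟨hu, hv⟩
  exact (dist_add_add_le _ _ _ _).trans_lt (add_lt_add hu hv)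

theorem stepPow_ball_pow_le (R : S → S → Measure E) [∀ a b, IsFiniteMeasure (R a b)]
    (n k : ℕ) (o : S) (s : E) (ρ : ℝ) (hk : 1 ≤ k) :
    stepPow R n o o (Metric.ball s ρ) ^ k ≤
      stepPow R (k * n) o o (Metric.ball ((k : ℝ) • s) (k * ρ)) := by
  induction k, hk using Nat.le_induction with
  | base => simp
  | succ k hk ih =>
    rw [pow_succ]
    refine (mul_le_mul' ih le_rfl).trans ((stepPow_ball_mul_le R _ _ o o o _ _ _ _).trans_eq ?_)
    congr 2
    · ring
    · push_cast; rw [add_smul, one_smul]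
    · push_cast; ring

theorem convex_loopEpigraph (R : S → S → Measure E) [∀ a b, IsFiniteMeasure (R a b)] (o : S) :
    Convex ℝ (loopEpigraph R o) := by
  refine (isClosed_loopEpigraph R o).convex_of_natCast_div ?_
  rintro ⟨x, r⟩ hx ⟨y, t⟩ hy p q hpq
  rcases Nat.eq_zero_or_pos p with rfl | hp
  · have : (q : ℝ) ≠ 0 := by rw [Nat.cast_ne_zero]; omega
    simpa [this] using hy
  rcases Nat.eq_zero_or_pos q with rfl | hq
  · have : (p : ℝ) ≠ 0 := by rw [Nat.cast_ne_zero]; omega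
    simpa [this] using hx
  intro ε hε
  obtain ⟨n, hn, h1⟩ := hx ε hε
  obtain ⟨m, hm, h2⟩ := hy ε hε
  have hk1 : 1 ≤ m * p := Nat.mul_pos (by omega) hp
  have hk2 : 1 ≤ n * q := Nat.mul_pos (by omega) hq
  refine ⟨n * m * (p + q), Nat.mul_pos (Nat.mul_pos (by omega) (by omega)) hpq, ?_⟩
  have key := (mul_le_mul' ((pow_le_pow_left' h1 (m * p)).trans
    (stepPow_ball_pow_le R n (m * p) o _ _ hk1)) ((pow_le_pow_left' h2 (n * q)).trans
    (stepPow_ball_pow_le R m (n * q) o _ _ hk2))).trans (stepPow_ball_mul_le R _ _ o o o _ _ _ _)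
  rw [← ofReal_exp_nsmul, ← ofReal_exp_nsmul, ← ofReal_exp_add] at key
  have hpq' : (p : ℝ) + q ≠ 0 := by positivity
  have e1 : m * p * n + n * q * m = n * m * (p + q) := by ring
  have e2 : ((n * m * (p + q) : ℕ) : ℝ) • ((((p : ℝ) / (p + q : ℕ)) • (x, r) +
      ((q : ℝ) / (p + q : ℕ)) • (y, t)).1) = ((m * p : ℕ) : ℝ) • (n : ℝ) • x +
      ((n * q : ℕ) : ℝ) • (m : ℝ) • y := by
    simp only [Prod.fst_add, Prod.smul_fst, smul_add, smul_smul]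
    push_cast
    congr 2 <;> field_simp
  have e3 : ((n * m * (p + q) : ℕ) : ℝ) * ε =
      ((m * p : ℕ) : ℝ) * (n * ε) + ((n * q : ℕ) : ℝ) * (m * ε) := by
    push_cast; ring
  have e4 : -(((n * m * (p + q) : ℕ) : ℝ) * ((((p : ℝ) / (p + q : ℕ)) • (x, r) +
      ((q : ℝ) / (p + q : ℕ)) • (y, t)).2 + ε)) =
      ((m * p : ℕ) : ℝ) * -(n * (r + ε)) + ((n * q : ℕ) : ℝ) * -(m * (t + ε)) := by
    simp only [Prod.snd_add, Prod.smul_snd, smul_eq_mul]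
    push_cast; field_simp; ring
  rw [e2, e3, e4, ← e1]
  exact key

end Epigraph

theorem exists_le_ofReal_exp {B : ℝ≥0∞} (hB : B ≠ ⊤) :
    ∃ b : ℝ, B ≤ ENNReal.ofReal (Real.exp b) := by
  refine ⟨B.toReal, ?_⟩
  rw [← ENNReal.ofReal_toReal hB, ENNReal.toReal_ofReal ENNReal.toReal_nonneg]
  exact ENNReal.ofReal_le_ofReal (by linarith [Real.add_one_le_exp B.toReal])

section Laplace

variable {S E : Type*} [Fintype S] [DecidableEq S] [NormedAddCommGroup E] [NormedSpace ℝ E]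
  [MeasurableSpace E] [BorelSpace E] [FiniteDimensional ℝ E]

/-- Laplace-type upper bound for the loop measures at `o`: an affine minorant of the decay rate
bounds the exponential growth of the corresponding exponential moments. -/
theorem lintegral_exp_stepPow_le (R : S → S → Measure E) [∀ a b, IsFiniteMeasure (R a b)]
    (hexp : ∀ κ : ℝ, ∃ C : ℝ≥0∞, C ≠ ⊤ ∧
      ∀ a b, ∫⁻ s, ENNReal.ofReal (Real.exp (κ * ‖s‖)) ∂(R a b) ≤ C)
    (o : S) (f : E →L[ℝ] ℝ) {γ γ' : ℝ} (hγ : γ < γ')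
    (hD : ∀ p ∈ loopEpigraph R o, f p.1 - p.2 ≤ γ) :
    ∃ C : ℝ≥0∞, C ≠ ⊤ ∧ ∀ n : ℕ, ∫⁻ s, ENNReal.ofReal (Real.exp (f s)) ∂(stepPow R n o o) ≤
      C * ENNReal.ofReal (Real.exp (n * γ')) := by
  have hproper : ProperSpace E := FiniteDimensional.proper_real E
  have hsc : SecondCountableTopology E := inferInstance
  obtain ⟨C₀, hC₀, hC₀R⟩ := hexp (‖f‖ + 1)
  obtain ⟨b, hb⟩ := exists_le_ofReal_exp
    (ENNReal.mul_ne_top (ENNReal.natCast_ne_top (Fintype.card S)) hC₀)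
  set r₀ : ℝ := max 0 (b - γ') with hr₀
  set η : ℝ := (γ' - γ) / 2 with hη
  have hη0 : 0 < η := by rw [hη]; linarith
  have hloc : ∀ y : E, ∃ ε > 0, ‖f‖ * ε ≤ η ∧ ∀ n : ℕ, 1 ≤ n →
      stepPow R n o o (Metric.ball ((n : ℝ) • y) (n * ε)) ≤
        ENNReal.ofReal (Real.exp (-(n * (f y - γ - η)))) := by
    intro y
    have hy : (y, f y - γ - η) ∉ loopEpigraph R o := fun h => by
      have := hD _ h
      simp only at this
      linarith
    simp only [loopEpigraph, Set.mem_ofPred_eq, not_forall, not_exists, not_and, not_le] at hy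
    obtain ⟨ε, hε, h⟩ := hy
    refine ⟨min ε (η / (‖f‖ + 1)), lt_min hε (by positivity), ?_, fun n hn => ?_⟩
    · calc ‖f‖ * min ε (η / (‖f‖ + 1)) ≤ ‖f‖ * (η / (‖f‖ + 1)) := by gcongr; exact min_le_right _ _
        _ ≤ (‖f‖ + 1) * (η / (‖f‖ + 1)) := by gcongr; linarith
        _ = η := by field_simp
    · refine (measure_mono (Metric.ball_subset_ball ?_)).trans ((h n hn).le.trans
        (ofReal_exp_mono ?_))
      · gcongr; exact min_le_left _ _
      · have : (0 : ℝ) ≤ n := Nat.cast_nonneg n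
        nlinarith [mul_nonneg this hε.le]
  choose ε hε hfε hW using hloc
  obtain ⟨T, -, hT⟩ := (isCompact_closedBall (0 : E) r₀).elim_nhds_subcover
    (fun y => Metric.ball y (ε y)) fun y _ => Metric.ball_mem_nhds y (hε y)
  refine ⟨T.card + 1, by simp, fun n => ?_⟩
  rcases Nat.eq_zero_or_pos n with rfl | hn
  · simp [stepPow, lintegral_dirac' _ (f := fun s => ENNReal.ofReal (Real.exp (f s)))
      (by fun_prop)]
  have hn0 : (0 : ℝ) < n := by exact_mod_cast hn
  have hpt : ∀ s : E, ENNReal.ofReal (Real.exp (f s)) ≤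
      (∑ y ∈ T, (Metric.ball ((n : ℝ) • y) (n * ε y)).indicator
        (fun _ => ENNReal.ofReal (Real.exp (n * (f y + η)))) s) +
      ENNReal.ofReal (Real.exp (-(n * r₀))) *
        ENNReal.ofReal (Real.exp ((‖f‖ + 1) * ‖s‖)) := by
    intro s
    by_cases hs : ‖s‖ ≤ n * r₀
    · have hmem : (n : ℝ)⁻¹ • s ∈ Metric.closedBall (0 : E) r₀ := by
        rw [mem_closedBall_zero_iff, norm_smul, norm_inv, Real.norm_natCast]
        rw [inv_mul_le_iff₀ hn0]; exact hs
      obtain ⟨y, hyT, hy⟩ := Set.mem_iUnion₂.1 (hT hmem)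
      have hy' : s ∈ Metric.ball ((n : ℝ) • y) (n * ε y) := by
        have h1 : s = (n : ℝ) • (n : ℝ)⁻¹ • s := by rw [smul_inv_smul₀ hn0.ne']
        rw [h1, Metric.mem_ball, dist_smul₀, Real.norm_natCast]
        exact mul_lt_mul_of_pos_left hy hn0
      refine le_trans ?_ (le_add_right (Finset.single_le_sum
        (f := fun y => (Metric.ball ((n : ℝ) • y) (n * ε y)).indicator
        (fun _ => ENNReal.ofReal (Real.exp (n * (f y + η)))) s) (fun _ _ => zero_le) hyT))
      rw [Set.indicator_of_mem hy']
      refine ofReal_exp_mono ?_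
      have h2 : f (s - (n : ℝ) • y) ≤ ‖f‖ * (n * ε y) :=
        (le_abs_self _).trans ((f.le_opNorm _).trans (by
          gcongr; exact (mem_ball_iff_norm.1 hy').le))
      rw [map_sub, map_smul, smul_eq_mul] at h2
      nlinarith [hfε y]
    · refine le_trans ?_ le_add_self
      rw [← ofReal_exp_add]
      refine ofReal_exp_mono ?_
      have := (le_abs_self _).trans (f.le_opNorm s)
      push Not at hs
      linarith
  have htail : ∫⁻ s, ENNReal.ofReal (Real.exp ((‖f‖ + 1) * ‖s‖)) ∂(stepPow R n o o) ≤
      ENNReal.ofReal (Real.exp (n * b)) := by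
    refine (lintegral_stepPow_le R n o o (by fun_prop) (by simp) (fun s t => ?_) hC₀R).trans ?_
    · rw [← ofReal_exp_add, ← mul_add]
      refine ofReal_exp_mono ?_
      gcongr
      exact norm_add_le s t
    · rw [ofReal_exp_nsmul]
      gcongr
  calc _ ≤ _ := lintegral_mono hpt
    _ = (∑ y ∈ T, ENNReal.ofReal (Real.exp (n * (f y + η))) *
          stepPow R n o o (Metric.ball ((n : ℝ) • y) (n * ε y))) +
        ENNReal.ofReal (Real.exp (-(n * r₀))) *
          ∫⁻ s, ENNReal.ofReal (Real.exp ((‖f‖ + 1) * ‖s‖)) ∂(stepPow R n o o) := by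
        rw [lintegral_add_right _ (by fun_prop), lintegral_const_mul _ (by fun_prop),
          lintegral_finsetSum _ fun y _ => measurable_const.indicator
            Metric.isOpen_ball.measurableSet]
        simp_rw [lintegral_indicator_const Metric.isOpen_ball.measurableSet]
    _ ≤ (∑ y ∈ T, ENNReal.ofReal (Real.exp (n * γ'))) + ENNReal.ofReal (Real.exp (n * γ')) := by
        refine add_le_add (Finset.sum_le_sum fun y _ => ?_) ?_
        · refine (mul_le_mul' le_rfl (hW y n hn)).trans ?_
          rw [← ofReal_exp_add]
          refine ofReal_exp_mono (le_of_eq ?_)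
          rw [hη]; ring
        · refine (mul_le_mul' le_rfl htail).trans ?_
          rw [← ofReal_exp_add]
          refine ofReal_exp_mono ?_
          nlinarith [le_max_right 0 (b - γ')]
    _ = _ := by rw [Finset.sum_const, nsmul_eq_mul]; ring

end Laplace

section Perron

variable {S : Type*} [Fintype S] [DecidableEq S]

theorem Matrix_mul_apply_le_pow_add (M : Matrix S S ℝ≥0∞) (m n : ℕ) (a b c : S) :
    (M ^ m) a c * (M ^ n) c b ≤ (M ^ (m + n)) a b := by
  rw [pow_add, Matrix.mul_apply]
  exact Finset.single_le_sum (f := fun c => (M ^ m) a c * (M ^ n) c b) (fun _ _ => zero_le)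
    (Finset.mem_univ c)

theorem Matrix_pow_apply_ne_zero {P : Matrix S S ℝ} {M : Matrix S S ℝ≥0∞}
    (hP : ∀ x y, 0 ≤ P x y) (h : ∀ x y, 0 < P x y → M x y ≠ 0) (n : ℕ) (x y : S)
    (hn : 0 < (P ^ n) x y) : (M ^ n) x y ≠ 0 := by
  induction n generalizing y with
  | zero =>
    by_cases hxy : x = y
    · simp [hxy]
    · simp [hxy] at hn
  | succ n ih =>
    rw [pow_succ, Matrix.mul_apply] at hn
    obtain ⟨z, -, hz⟩ := Finset.exists_lt_of_sum_lt (s := Finset.univ) (f := fun _ => (0 : ℝ))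
      (by simpa using hn)
    have hzy : 0 < P z y := (hP z y).lt_of_ne fun h => by simp [← h] at hz
    have hxz : 0 < (P ^ n) x z := pos_of_mul_pos_left hz hzy.le
    refine ne_of_gt (lt_of_lt_of_le ?_ (Matrix_mul_apply_le_pow_add M n 1 x y z))
    rw [pow_one]
    exact pos_iff_ne_zero.2 (mul_ne_zero (ih z hxz) (h z y hzy))

/-- A nonnegative irreducible matrix whose powers grow at a rate less than `exp γ'` at one
diagonal entry has a positive `exp γ'`-subinvariant vector. -/
theorem exists_subinvariant_vector (M : Matrix S S ℝ≥0∞) (o : S)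
    (hirr : ∀ x y, ∃ n : ℕ, (M ^ n) x y ≠ 0) {C : ℝ≥0∞} (hC : C ≠ ⊤) {γ γ' : ℝ} (hγ : γ < γ')
    (hM : ∀ n : ℕ, (M ^ n) o o ≤ C * ENNReal.ofReal (Real.exp (n * γ))) :
    ∃ v : S → ℝ, (∀ x, 0 < v x) ∧
      ∀ x, ∑ y, M x y * ENNReal.ofReal (v y) ≤ ENNReal.ofReal (Real.exp γ' * v x) := by
  set V : S → ℝ≥0∞ := fun x => ∑' n : ℕ, ENNReal.ofReal (Real.exp (-(n * γ'))) * (M ^ n) x o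
    with hV
  have hVtop : ∀ x, V x ≠ ⊤ := by
    intro x
    obtain ⟨j, hj⟩ := hirr o x
    have hgeom : (M ^ j) o x * V x ≤ C * ENNReal.ofReal (Real.exp (j * γ)) *
        ∑' n : ℕ, ENNReal.ofReal (Real.exp (γ - γ')) ^ n := by
      rw [hV, ← ENNReal.tsum_mul_left, ← ENNReal.tsum_mul_left]
      refine ENNReal.tsum_le_tsum fun n => ?_
      calc _ = ENNReal.ofReal (Real.exp (-(n * γ'))) * ((M ^ j) o x * (M ^ n) x o) := by ring
        _ ≤ ENNReal.ofReal (Real.exp (-(n * γ'))) *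
            (C * ENNReal.ofReal (Real.exp ((j + n : ℕ) * γ))) := by
            exact mul_le_mul' le_rfl ((Matrix_mul_apply_le_pow_add M j n o o x).trans (hM _))
        _ = C * (ENNReal.ofReal (Real.exp (-(n * γ'))) *
            ENNReal.ofReal (Real.exp ((j + n : ℕ) * γ))) := by ring
        _ = _ := by
          rw [mul_assoc, ← ofReal_exp_nsmul, ← ofReal_exp_add, ← ofReal_exp_add]
          push_cast; ring_nf
    intro htop
    rw [htop, ENNReal.mul_top hj, top_le_iff, ENNReal.tsum_geometric] at hgeom
    refine ENNReal.mul_ne_top (ENNReal.mul_ne_top hC ENNReal.ofReal_ne_top) ?_ hgeom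
    rw [ENNReal.inv_ne_top, Ne, tsub_eq_zero_iff_le, not_le, ENNReal.ofReal_lt_one,
      Real.exp_lt_one_iff]
    linarith
  have hV0 : ∀ x, V x ≠ 0 := by
    intro x h
    obtain ⟨j, hj⟩ := hirr x o
    rw [hV] at h
    have := (ENNReal.tsum_eq_zero.1 h) j
    exact mul_ne_zero (ofReal_exp_ne_zero _) hj this
  refine ⟨fun x => (V x).toReal, fun x => ENNReal.toReal_pos (hV0 x) (hVtop x), fun x => ?_⟩
  rw [ENNReal.ofReal_mul (Real.exp_pos _).le]
  simp_rw [ENNReal.ofReal_toReal (hVtop _)]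
  calc ∑ y, M x y * V y
      = ∑ y, ∑' n : ℕ, M x y * (ENNReal.ofReal (Real.exp (-(n * γ'))) * (M ^ n) y o) := by
        simp_rw [hV, ENNReal.tsum_mul_left]
    _ = ∑' n : ℕ, ∑ y, M x y * (ENNReal.ofReal (Real.exp (-(n * γ'))) * (M ^ n) y o) :=
        (Summable.tsum_finsetSum fun _ _ => ENNReal.summable).symm
    _ = ∑' n : ℕ, ENNReal.ofReal (Real.exp γ') *
          (ENNReal.ofReal (Real.exp (-((n + 1 : ℕ) * γ'))) * (M ^ (n + 1)) x o) := by
        refine tsum_congr fun n => ?_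
        rw [← mul_assoc, ← ofReal_exp_add, pow_succ', Matrix.mul_apply, Finset.mul_sum]
        refine Finset.sum_congr rfl fun y _ => ?_
        rw [show γ' + -(((n + 1 : ℕ) : ℝ) * γ') = -(n * γ') by push_cast; ring]
        ring
    _ ≤ _ := by
        rw [ENNReal.tsum_mul_left]
        gcongr
        exact ENNReal.tsum_comp_le_tsum_of_injective Nat.succ_injective
          (fun n : ℕ => ENNReal.ofReal (Real.exp (-(n * γ'))) * (M ^ n) x o)

end Perron

theorem exists_ball_ne_zero {E : Type*} [NormedAddCommGroup E] [MeasurableSpace E]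
    {μ : Measure E} (hμ : μ ≠ 0) :
    ∃ ρ : ℝ, μ (Metric.ball 0 ρ) ≠ 0 := by
  by_contra! h
  refine hμ (Measure.measure_univ_eq_zero.1 ?_)
  rw [← Metric.iUnion_ball_nat (0 : E)]
  exact measure_iUnion_null fun n => h n

section Duality

variable {S E : Type*} [Fintype S] [DecidableEq S] [NormedAddCommGroup E] [NormedSpace ℝ E]
  [MeasurableSpace E] [BorelSpace E] [FiniteDimensional ℝ E]

/-- Dual criterion: a point lies in the loop epigraph as soon as it lies above all affine functions
`f - γ` where `γ` is an exponential growth rate of the `f`-exponential moments. -/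
theorem mem_loopEpigraph_of_dual (R : S → S → Measure E) [∀ a b, IsFiniteMeasure (R a b)]
    (hexp : ∀ κ : ℝ, ∃ C : ℝ≥0∞, C ≠ ⊤ ∧
      ∀ a b, ∫⁻ s, ENNReal.ofReal (Real.exp (κ * ‖s‖)) ∂(R a b) ≤ C)
    (o : S) (hmass : ∀ n, stepPow R n o o Set.univ ≤ 1) (z : E) (c : ℝ)
    (hdual : ∀ (f : E →L[ℝ] ℝ) (γ : ℝ), (∃ C : ℝ≥0∞, C ≠ ⊤ ∧ ∀ n : ℕ,
      ∫⁻ s, ENNReal.ofReal (Real.exp (f s)) ∂(stepPow R n o o) ≤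
        C * ENNReal.ofReal (Real.exp (n * γ))) → f z - γ ≤ c) :
    (z, c) ∈ loopEpigraph R o := by
  have hdual' : ∀ (f : E →L[ℝ] ℝ) (γ : ℝ), (∀ p ∈ loopEpigraph R o, f p.1 - p.2 ≤ γ) →
      f z - γ ≤ c := by
    intro f γ h
    refine le_of_forall_pos_le_add fun δ hδ => ?_
    have := hdual f (γ + δ) (lintegral_exp_stepPow_le R hexp o f (by linarith) h)
    linarith
  by_contra hz
  obtain ⟨F, u, hFu, huF⟩ := geometric_hahn_banach_closed_point (convex_loopEpigraph R o)
    (isClosed_loopEpigraph R o) hz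
  set f : E →L[ℝ] ℝ := F.comp (ContinuousLinearMap.inl ℝ E ℝ) with hf
  set β : ℝ := F (0, 1) with hβ
  have hF : ∀ y r, F (y, r) = f y + r * β := by
    intro y r
    have : ((y, r) : E × ℝ) = (y, 0) + r • (0, 1) := by simp
    rw [this, map_add, map_smul, hf, hβ]
    simp
  rw [hF] at huF
  rcases (loopEpigraph R o).eq_empty_or_nonempty with hempty | ⟨⟨y₀, t₀⟩, h₀⟩
  · have := hdual' 0 (-c - 1) (by simp [hempty])
    simp at this
    linarith
  have hβ0 : β ≤ 0 := by
    by_contra! hpos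
    have h1 := hFu _ (mem_loopEpigraph_mono (r' := max t₀ ((u - f y₀) / β)) h₀ (le_max_left _ _))
    rw [hF] at h1
    have h2 : (u - f y₀) / β * β = u - f y₀ := by field_simp
    have h3 := mul_le_mul_of_nonneg_right (le_max_right t₀ ((u - f y₀) / β)) hpos.le
    linarith
  rcases hβ0.lt_or_eq with hneg | hzero
  · have h3 : (0 : ℝ) < (-β)⁻¹ := by rw [inv_pos]; linarith
    have h4 : (-β)⁻¹ * β = -1 := by rw [inv_neg, neg_mul, inv_mul_cancel₀ hneg.ne]
    have h5 : ∀ w r : ℝ, (-β)⁻¹ * (w + r * β) = (-β)⁻¹ * w - r := fun w r => by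
      linear_combination r * h4
    have h1 := hdual' ((-β)⁻¹ • f) ((-β)⁻¹ * u) (by
      rintro ⟨y, r⟩ hp
      have h2 := hFu _ hp
      rw [hF] at h2
      have h6 := mul_lt_mul_of_pos_left h2 h3
      rw [h5] at h6
      simpa using h6.le)
    simp only [smul_apply, smul_eq_mul] at h1
    have h6 := mul_lt_mul_of_pos_left huF h3
    rw [h5] at h6
    linarith
  · rw [hzero, mul_zero, add_zero] at huF
    have key : ∀ s : ℝ, 0 ≤ s → s * (f z - u) ≤ c := by
      intro s hs
      have h1 := hdual' (s • f) (s * u) (by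
        rintro ⟨y, r⟩ hp
        have h2 := hFu _ hp
        have h3 := nonneg_of_mem_loopEpigraph hmass hp
        rw [hF, hzero, mul_zero, add_zero] at h2
        simp only [smul_apply, smul_eq_mul] at h3 ⊢
        nlinarith)
      simp only [smul_apply, smul_eq_mul] at h1
      linarith
    have hpos : 0 < f z - u := by linarith
    have h5 := key ((|c| + 1) / (f z - u)) (by positivity)
    rw [div_mul_cancel₀ _ hpos.ne'] at h5
    linarith [le_abs_self c]

/-- Points of the loop epigraph at `o` give lower bounds for the `n`-step kernels from any state
leading to `o`, for all large `n`. -/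
theorem exists_eventually_le_stepPow (R : S → S → Measure E) [∀ a b, IsFiniteMeasure (R a b)]
    {o a : S} {z : E} {c : ℝ} (hz : (z, c) ∈ loopEpigraph R o) (hc : 0 ≤ c)
    (hreach : ∃ j, stepPow R j a o ≠ 0) (hlive : ∀ i, ∃ b, stepPow R i o b ≠ 0)
    {ε : ℝ} (hε : 0 < ε) :
    ∃ δ : ℝ≥0∞, δ ≠ 0 ∧ ∀ᶠ n : ℕ in atTop, ∃ b,
      δ * ENNReal.ofReal (Real.exp (-(n * (c + ε)))) ≤
        stepPow R n a b (Metric.ball ((n : ℝ) • z) (n * ε)) := by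
  obtain ⟨n₀, hn₀, h₀⟩ := hz (ε / 2) (by positivity)
  obtain ⟨j, hj⟩ := hreach
  choose b hb using hlive
  obtain ⟨ρ, hρ⟩ := exists_ball_ne_zero hj
  choose σ hσ using fun i => exists_ball_ne_zero (hb i)
  set δ₂ : ℝ≥0∞ := (Finset.range n₀).inf fun i => stepPow R i o (b i) (Metric.ball 0 (σ i))
    with hδ₂
  have hδ₂0 : δ₂ ≠ 0 := by
    rw [← pos_iff_ne_zero, hδ₂, Finset.lt_inf_iff (by simp)]
    exact fun i _ => pos_iff_ne_zero.2 (hσ i)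
  set L : ℝ := ρ + (∑ i ∈ Finset.range n₀, |σ i|) + (j + n₀) * ‖z‖ with hL
  refine ⟨stepPow R j a o (Metric.ball 0 ρ) * δ₂, mul_ne_zero hρ hδ₂0, ?_⟩
  filter_upwards [eventually_ge_atTop (j + n₀), eventually_ge_atTop ⌈2 * L / ε⌉₊] with n hn1 hn2
  set k := (n - j) / n₀ with hk
  set i := (n - j) % n₀ with hi
  have hi' : i < n₀ := Nat.mod_lt _ (by omega)
  have hk1 : 1 ≤ k := (Nat.one_le_div_iff (by omega)).2 (by omega)
  have hdecomp : n = j + k * n₀ + i := by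
    have := Nat.div_add_mod' (n - j) n₀
    rw [← hk, ← hi] at this
    omega
  refine ⟨b i, ?_⟩
  have hpow := (pow_le_pow_left' h₀ k).trans (stepPow_ball_pow_le R n₀ k o _ _ hk1)
  rw [← ofReal_exp_nsmul] at hpow
  have hchain := (mul_le_mul' (mul_le_mul' (le_refl (stepPow R j a o (Metric.ball 0 ρ))) hpow)
    (le_refl (stepPow R i o (b i) (Metric.ball 0 (σ i))))).trans
    ((mul_le_mul' (stepPow_ball_mul_le R _ _ a o o _ _ _ _) le_rfl).trans
      (stepPow_ball_mul_le R _ _ a (b i) o _ _ _ _))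
  rw [← hdecomp, zero_add, add_zero] at hchain
  have hkn : (k : ℝ) * n₀ ≤ n := by
    have : k * n₀ ≤ n := by omega
    exact_mod_cast this
  have hkn' : (n : ℝ) - k * n₀ ≤ j + n₀ := by
    have : n ≤ k * n₀ + (j + n₀) := by omega
    have : (n : ℝ) ≤ k * n₀ + (j + n₀) := by exact_mod_cast this
    linarith
  calc _ = stepPow R j a o (Metric.ball 0 ρ) * ENNReal.ofReal (Real.exp (-(n * (c + ε)))) * δ₂ := by
        ring
    _ ≤ _ := by
        refine mul_le_mul' (mul_le_mul' le_rfl (ofReal_exp_mono ?_))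
          (Finset.inf_le (Finset.mem_range.2 hi'))
        have : (k : ℝ) * n₀ * (c + ε / 2) ≤ n * (c + ε) :=
          mul_le_mul hkn (by linarith) (by linarith) (by positivity)
        simp only
        linarith
    _ ≤ _ := hchain
    _ ≤ _ := by
        refine measure_mono (Metric.ball_subset_ball' ?_)
        have h1 : dist ((k : ℝ) • (n₀ : ℝ) • z) ((n : ℝ) • z) = (n - k * n₀) * ‖z‖ := by
          rw [dist_eq_norm, smul_smul, ← sub_smul, norm_smul, Real.norm_eq_abs, abs_sub_comm,
            abs_of_nonneg (by linarith)]
        have h2 : ((n : ℝ) - k * n₀) * ‖z‖ ≤ (j + n₀) * ‖z‖ := by gcongr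
        have h3 : σ i ≤ ∑ i ∈ Finset.range n₀, |σ i| := (le_abs_self _).trans
          (Finset.single_le_sum (f := fun i => |σ i|) (fun _ _ => abs_nonneg _)
            (Finset.mem_range.2 hi'))
        have h4 : 2 * L / ε ≤ n := (Nat.le_ceil _).trans (by exact_mod_cast hn2)
        rw [div_le_iff₀ hε] at h4
        simp only
        rw [h1]
        nlinarith

end Duality

theorem EReal.coe_lt_add_exists {x y : EReal} (hx : 0 ≤ x) (hy : 0 ≤ y) {α : ℝ}
    (h : (α : EReal) < x + y) :
    ∃ r s : ℝ, (r : EReal) < x ∧ (s : EReal) < y ∧ α < r + s := by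
  induction x with
  | bot => simp at hx
  | top =>
    obtain ⟨s, hs⟩ := EReal.lt_iff_exists_real_btwn.1 (EReal.bot_lt_zero.trans_le hy)
    exact ⟨α - s + 1, s, EReal.coe_lt_top _, hs.2, by linarith⟩
  | coe x =>
    induction y with
    | bot => simp at hy
    | top => exact ⟨x - 1, α - x + 2, by exact_mod_cast sub_one_lt x, EReal.coe_lt_top _,
        by linarith⟩
    | coe y =>
      rw [← EReal.coe_add, EReal.coe_lt_coe_iff] at h
      exact ⟨x - (x + y - α) / 3, y - (x + y - α) / 3, EReal.coe_lt_coe_iff.2 (by linarith),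
        EReal.coe_lt_coe_iff.2 (by linarith), by linarith⟩

theorem EReal.coe_lt_sum_exists {ι : Type*} (t : Finset ι) {a : ι → EReal}
    (ha : ∀ i, 0 ≤ a i) {α : ℝ} (h : (α : EReal) < ∑ i ∈ t, a i) :
    ∃ r : ι → ℝ, (∀ i ∈ t, (r i : EReal) < a i) ∧ α < ∑ i ∈ t, r i := by
  induction t using Finset.induction_on generalizing α with
  | empty => exact ⟨0, by simp, by simpa using h⟩
  | insert i t hi ih =>
    rw [Finset.sum_insert hi] at h
    obtain ⟨r, s, hr, hs, hrs⟩ :=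
      EReal.coe_lt_add_exists (ha i) (Finset.sum_nonneg fun j _ => ha j) h
    obtain ⟨f, hf, hsf⟩ := ih hs
    refine ⟨Function.update f i r, fun j hj => ?_, ?_⟩
    · rcases Finset.mem_insert.1 hj with rfl | hjt
      · simpa using hr
      · rw [Function.update_of_ne (by rintro rfl; exact hi hjt)]
        exact hf j hjt
    · rw [Finset.sum_insert hi, Finset.sum_update_of_notMem hi, Function.update_self]
      linarith

/-- The real-valued logarithmic moment generating function. -/
def realLogMGF {d : ℕ} (q : Measure (Fin d → ℝ)) (l : Fin d → ℝ) : ℝ := (logMGF q l).toReal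

section Moments

variable {d : ℕ}

theorem measurable_l1norm : Measurable (l1norm : (Fin d → ℝ) → ℝ) := by
  unfold l1norm; fun_prop

theorem continuous_dotp (l : Fin d → ℝ) : Continuous (dotp l) := by
  unfold dotp; fun_prop

theorem dotp_le_mul_l1norm (l a : Fin d → ℝ) : dotp l a ≤ l1norm l * l1norm a := by
  unfold dotp l1norm
  rw [Finset.sum_mul]
  refine Finset.sum_le_sum fun i _ => (le_abs_self _).trans ?_
  rw [abs_mul]
  gcongr
  exact Finset.single_le_sum (f := fun i => |a i|) (fun _ _ => abs_nonneg _) (Finset.mem_univ i)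

theorem lintegral_exp_ne_zero {α : Type*} [MeasurableSpace α] (q : Measure α)
    [IsProbabilityMeasure q] {f : α → ℝ} (hf : Measurable f) :
    ∫⁻ a, ENNReal.ofReal (Real.exp (f a)) ∂q ≠ 0 := by
  rw [Ne, lintegral_eq_zero_iff (by fun_prop)]
  intro h
  have h2 : ∀ᵐ a ∂q, False := h.mono fun a ha => ofReal_exp_ne_zero _ ha
  simp [IsProbabilityMeasure.ne_zero] at h2

theorem l1norm_nonneg (a : Fin d → ℝ) : 0 ≤ l1norm a :=
  Finset.sum_nonneg fun _ _ => abs_nonneg _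

/-- Superlinear growth of the conjugate forces all exponential moments to be finite. -/
theorem Superlinear.lintegral_exp_ne_top {q : Measure (Fin d → ℝ)} [IsProbabilityMeasure q]
    (h : Superlinear q) (s : ℝ) :
    ∫⁻ a, ENNReal.ofReal (Real.exp (s * l1norm a)) ∂q ≠ ⊤ := by
  intro htop
  obtain ⟨m, hm⟩ : ∃ m : ℕ, q {a | l1norm a ≤ m} ≠ 0 := by
    by_contra! hall
    refine IsProbabilityMeasure.ne_zero q (Measure.measure_univ_eq_zero.1 ?_)
    rw [show (Set.univ : Set (Fin d → ℝ)) = ⋃ m : ℕ, {a | l1norm a ≤ m} from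
      (Set.eq_univ_of_forall fun a => Set.mem_iUnion.2 (exists_nat_ge (l1norm a))).symm]
    exact measure_iUnion_null hall
  set κ : ℝ := Real.log (q {a | l1norm a ≤ m}).toReal with hκ
  have hqpos : 0 < (q {a | l1norm a ≤ m}).toReal := ENNReal.toReal_pos hm (measure_ne_top _ _)
  have hκ0 : κ ≤ 0 := Real.log_nonpos hqpos.le (ENNReal.toReal_le_of_le_ofReal zero_le_one
    (by simpa using prob_le_one))
  have hbound : ∀ r : ℝ, m ≤ r → cramerTransformAbs q r ≤ ((r * |s| - κ : ℝ) : EReal) := by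
    intro r hr
    have hr0 : 0 ≤ r := (Nat.cast_nonneg m).trans hr
    refine iSup_le fun t => ?_
    rcases le_or_gt s t with hst | hst
    · have : logMGFAbs q t = ⊤ := by
        rw [logMGFAbs, ENNReal.log_eq_top_iff, ← top_le_iff, ← htop]
        refine lintegral_mono fun a => ofReal_exp_mono ?_
        exact mul_le_mul_of_nonneg_right hst (l1norm_nonneg a)
      rw [this]
      simp
    have hlow : ((min 0 (t * m) + κ : ℝ) : EReal) ≤ logMGFAbs q t := by
      rw [logMGFAbs, ← Real.log_exp (min 0 (t * m) + κ), ← ENNReal.log_ofReal_of_pos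
        (Real.exp_pos _), ENNReal.log_le_log_iff, ofReal_exp_add, hκ, Real.exp_log hqpos,
        ENNReal.ofReal_toReal (measure_ne_top _ _), ← setLIntegral_const]
      refine (setLIntegral_mono (measurable_l1norm.const_mul t).exp.ennreal_ofReal
        fun a (ha : l1norm a ≤ m) => ofReal_exp_mono ?_).trans (setLIntegral_le_lintegral _ _)
      rcases le_or_gt 0 t with ht | ht
      · exact (min_le_left _ _).trans (mul_nonneg ht (l1norm_nonneg a))
      · exact (min_le_right _ _).trans (mul_le_mul_of_nonpos_left ha ht.le)
    refine (EReal.sub_le_sub le_rfl hlow).trans ?_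
    rw [← EReal.coe_sub, EReal.coe_le_coe_iff]
    have h1 : r * t ≤ r * |s| := by gcongr; exact hst.le.trans (le_abs_self s)
    have h2 : 0 ≤ r * |s| := by positivity
    rcases min_cases 0 (t * (m : ℝ)) with ⟨he, _⟩ | ⟨he, hlt⟩
    · rw [he]; linarith
    · rw [he]
      have ht : t ≤ 0 := by
        by_contra! hpos
        exact absurd hlt (not_lt.2 (mul_nonneg hpos.le (Nat.cast_nonneg m)))
      nlinarith
  have hle : Filter.liminf (fun r : ℝ => cramerTransformAbs q r / (r : EReal)) Filter.atTop ≤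
      ((|s| - κ : ℝ) : EReal) := by
    refine (Filter.liminf_le_liminf ?_).trans (Filter.liminf_const _).le
    filter_upwards [eventually_ge_atTop (m : ℝ), eventually_ge_atTop (1 : ℝ)] with r hr hr1
    have hr0 : (0 : EReal) ≤ (r : EReal) := by exact_mod_cast zero_le_one.trans hr1
    refine (EReal.div_le_div_right_of_nonneg hr0 (hbound r hr)).trans ?_
    rw [← EReal.coe_div, EReal.coe_le_coe_iff, div_le_iff₀ (by linarith)]
    nlinarith
  rw [h] at hle
  exact absurd hle (not_le.2 (EReal.coe_lt_top _))

theorem lintegral_exp_dotp {q : Measure (Fin d → ℝ)} [IsProbabilityMeasure q]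
    (h : ∀ s : ℝ, ∫⁻ a, ENNReal.ofReal (Real.exp (s * l1norm a)) ∂q ≠ ⊤) (l : Fin d → ℝ) :
    ∫⁻ a, ENNReal.ofReal (Real.exp (dotp l a)) ∂q = ENNReal.ofReal (Real.exp (realLogMGF q l)) ∧
      logMGF q l = (realLogMGF q l : EReal) := by
  set I := ∫⁻ a, ENNReal.ofReal (Real.exp (dotp l a)) ∂q with hI
  have h0 : I ≠ 0 := lintegral_exp_ne_zero q (continuous_dotp l).measurable
  have htop : I ≠ ⊤ := ne_top_of_le_ne_top (h (l1norm l))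
    (lintegral_mono fun a => ofReal_exp_mono (dotp_le_mul_l1norm l a))
  have hlog : logMGF q l = (Real.log I.toReal : EReal) := ENNReal.log_pos_real h0 htop
  have hreal : realLogMGF q l = Real.log I.toReal := by rw [realLogMGF, hlog, EReal.toReal_coe]
  refine ⟨?_, by rw [hlog, hreal]⟩
  rw [hreal, Real.exp_log (ENNReal.toReal_pos h0 htop), ENNReal.ofReal_toReal htop]

end Moments

theorem EReal.coe_sum_finset {ι : Type*} (t : Finset ι) (f : ι → ℝ) :
    ((∑ i ∈ t, f i : ℝ) : EReal) = ∑ i ∈ t, (f i : EReal) := by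
  induction t using Finset.induction_on with
  | empty => simp
  | insert i t hi ih => rw [Finset.sum_insert hi, Finset.sum_insert hi, EReal.coe_add, ih]

theorem sEnt_ge (a b w : ℝ) : ((a * w - b * (Real.exp w - 1) : ℝ) : EReal) ≤ sEnt a b := by
  unfold sEnt
  split_ifs with h h'
  · obtain ⟨ha, hb⟩ := h
    rw [EReal.coe_le_coe_iff]
    have h1 := Real.log_le_sub_one_of_pos (show 0 < b * Real.exp w / a by positivity)
    rw [Real.log_div (by positivity) ha.ne', Real.log_mul hb.ne' (Real.exp_pos w).ne',
      Real.log_exp] at h1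
    rw [Real.log_div ha.ne' hb.ne']
    have h2 := mul_le_mul_of_nonneg_left h1 ha.le
    rw [show a * (b * Real.exp w / a - 1) = b * Real.exp w - a by field_simp] at h2
    linarith
  · obtain ⟨rfl, hb⟩ := h'
    rw [EReal.coe_le_coe_iff]
    nlinarith [Real.exp_pos w]
  · exact le_top

theorem sEnt_nonneg (a b : ℝ) : 0 ≤ sEnt a b := by simpa using sEnt_ge a b 0

theorem exists_lt_of_lt_sEnt {a b r : ℝ} (ha : 0 ≤ a) (hb : 0 ≤ b) (h : (r : EReal) < sEnt a b) :
    ∃ w : ℝ, r < a * w - b * (Real.exp w - 1) := by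
  rcases ha.eq_or_lt with rfl | ha
  · simp only [sEnt, lt_irrefl, false_and, if_false, true_and, if_pos hb,
      EReal.coe_lt_coe_iff] at h
    rcases hb.eq_or_lt with rfl | hb
    · exact ⟨0, by simpa using h⟩
    · refine ⟨Real.log ((b - r) / (2 * b)), ?_⟩
      rw [Real.exp_log (div_pos (by linarith) (by linarith))]
      field_simp
      linarith
  rcases hb.eq_or_lt with rfl | hb
  · refine ⟨(r + 1) / a, ?_⟩
    rw [mul_div_cancel₀ _ ha.ne']
    linarith
  · refine ⟨Real.log (a / b), ?_⟩
    rw [sEnt, if_pos ⟨ha, hb⟩, EReal.coe_lt_coe_iff] at h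
    rw [Real.exp_log (by positivity), mul_sub, mul_div_cancel₀ _ hb.ne']
    linarith

section Cramer

variable {d : ℕ}

theorem dotp_zero_left (a : Fin d → ℝ) : dotp 0 a = 0 := by simp [dotp]

theorem dotp_zero_right (l : Fin d → ℝ) : dotp l 0 = 0 := by simp [dotp]

theorem dotp_smul_right (l a : Fin d → ℝ) (t : ℝ) : dotp l (t • a) = t * dotp l a := by
  simp only [dotp, Finset.mul_sum, Pi.smul_apply, smul_eq_mul]
  exact Finset.sum_congr rfl fun i _ => by ring

theorem dotp_smul_left (l a : Fin d → ℝ) (t : ℝ) : dotp (t • l) a = t * dotp l a := by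
  simp only [dotp, Finset.mul_sum, Pi.smul_apply, smul_eq_mul]
  exact Finset.sum_congr rfl fun i _ => by ring

theorem dotp_add_right (l a b : Fin d → ℝ) : dotp l (a + b) = dotp l a + dotp l b := by
  simp only [dotp, ← Finset.sum_add_distrib, Pi.add_apply]
  exact Finset.sum_congr rfl fun i _ => by ring

theorem dotp_self_pos {a : Fin d → ℝ} (ha : a ≠ 0) : 0 < dotp a a := by
  obtain ⟨i, hi⟩ := Function.ne_iff.1 ha
  refine Finset.sum_pos' (fun j _ => mul_self_nonneg _) ⟨i, Finset.mem_univ i, ?_⟩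
  exact mul_self_pos.2 hi

/-- All exponential moments of the `ℓ¹`-norm are finite. -/
def ExpMoments (q : Measure (Fin d → ℝ)) : Prop :=
  ∀ s : ℝ, ∫⁻ a, ENNReal.ofReal (Real.exp (s * l1norm a)) ∂q ≠ ⊤

variable {q : Measure (Fin d → ℝ)} [IsProbabilityMeasure q]

theorem realLogMGF_zero : realLogMGF q 0 = 0 := by
  simp [realLogMGF, logMGF, dotp_zero_left]

theorem le_mul_cramerTransform (h : ExpMoments q) {θ : ℝ} (hθ : 0 ≤ θ) {k : Fin d → ℝ}
    (hk : θ = 0 → k = 0) (l : Fin d → ℝ) :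
    ((dotp l k - θ * realLogMGF q l : ℝ) : EReal) ≤ (θ : EReal) * cramerTransform q (θ⁻¹ • k) := by
  rcases hθ.eq_or_lt with rfl | hθ
  · simp [hk rfl, dotp_zero_right]
  have h1 : ((dotp l (θ⁻¹ • k) - realLogMGF q l : ℝ) : EReal) ≤ cramerTransform q (θ⁻¹ • k) := by
    rw [EReal.coe_sub, ← (lintegral_exp_dotp h l).2]
    exact le_iSup (fun l => ((dotp l (θ⁻¹ • k) : ℝ) : EReal) - logMGF q l) l
  refine le_trans (le_of_eq ?_) (mul_le_mul_of_nonneg_left h1 (EReal.coe_nonneg.2 hθ.le))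
  rw [← EReal.coe_mul, dotp_smul_right]
  congr 1
  field_simp

theorem mul_cramerTransform_nonneg (h : ExpMoments q) {θ : ℝ} (hθ : 0 ≤ θ) {k : Fin d → ℝ}
    (hk : θ = 0 → k = 0) : 0 ≤ (θ : EReal) * cramerTransform q (θ⁻¹ • k) := by
  simpa [dotp_zero_left, realLogMGF_zero] using le_mul_cramerTransform h hθ hk 0

theorem exists_lt_of_lt_mul_cramerTransform (h : ExpMoments q) {θ r : ℝ} (hθ : 0 ≤ θ)
    {k : Fin d → ℝ} (hr : (r : EReal) < (θ : EReal) * cramerTransform q (θ⁻¹ • k)) :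
    ∃ l, r < dotp l k - θ * realLogMGF q l := by
  rcases hθ.eq_or_lt with rfl | hθ
  · exact ⟨0, by simpa [dotp_zero_left] using hr⟩
  have h1 : ((r / θ : ℝ) : EReal) < cramerTransform q (θ⁻¹ • k) := by
    by_contra! hle
    have h2 := mul_le_mul_of_nonneg_left hle (EReal.coe_nonneg.2 hθ.le)
    rw [← EReal.coe_mul, mul_div_cancel₀ _ hθ.ne'] at h2
    exact absurd hr (not_lt.2 h2)
  obtain ⟨l, hl⟩ := lt_iSup_iff.1 h1
  refine ⟨l, ?_⟩
  rw [(lintegral_exp_dotp h l).2, ← EReal.coe_sub, EReal.coe_lt_coe_iff, dotp_smul_right,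
    div_lt_iff₀ hθ] at hl
  refine hl.trans_le (le_of_eq ?_)
  field_simp

end Cramer

section RateFunction

variable {S : Type*} [Fintype S] {d : ℕ}

/-- The linear functional on pairs `(k, θ)` with coefficients `l` and `u`. -/
def linForm (l : S × S → (Fin d → ℝ)) (u : S × S → ℝ)
    (z : (S × S → (Fin d → ℝ)) × (S × S → ℝ)) : ℝ :=
  ∑ p, (dotp (l p) (z.1 p) + u p * z.2 p)

/-- The coefficients of `θ` in the functional obtained by dualising every term of the rate function
at `l` and `w`, up to the coboundary of `g`. -/
def tiltPot (P : S → S → ℝ) (q : S → S → Measure (Fin d → ℝ)) (l : S × S → (Fin d → ℝ))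
    (w : S × S → ℝ) (g : S → ℝ) (p : S × S) : ℝ :=
  w p - realLogMGF (q p.1 p.2) (l p) + g p.2 - g p.1
    - ∑ y, P p.1 y * (Real.exp (w (p.1, y)) - 1)

theorem continuous_linForm (l : S × S → (Fin d → ℝ)) (u : S × S → ℝ) :
    Continuous (linForm l u) := by
  unfold linForm dotp
  fun_prop

theorem linForm_add (l : S × S → (Fin d → ℝ)) (u : S × S → ℝ)
    (z z' : (S × S → (Fin d → ℝ)) × (S × S → ℝ)) :
    linForm l u (z + z') = linForm l u z + linForm l u z' := by
  simp only [linForm, ← Finset.sum_add_distrib]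
  refine Finset.sum_congr rfl fun p _ => ?_
  rw [Prod.fst_add, Prod.snd_add, Pi.add_apply, Pi.add_apply, dotp_add_right]
  ring

theorem linForm_zero (l : S × S → (Fin d → ℝ)) (u : S × S → ℝ) : linForm l u 0 = 0 := by
  simp [linForm, dotp_zero_right]

theorem linForm_smul (l : S × S → (Fin d → ℝ)) (u : S × S → ℝ) (t : ℝ)
    (z : (S × S → (Fin d → ℝ)) × (S × S → ℝ)) :
    linForm l u (t • z) = t * linForm l u z := by
  simp only [linForm, Finset.mul_sum]
  refine Finset.sum_congr rfl fun p _ => ?_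
  rw [Prod.smul_fst, Prod.smul_snd, Pi.smul_apply, Pi.smul_apply, dotp_smul_right, smul_eq_mul]
  ring

theorem linForm_tiltPot (P : S → S → ℝ) (q : S → S → Measure (Fin d → ℝ))
    (l : S × S → (Fin d → ℝ)) (w : S × S → ℝ) (g : S → ℝ)
    (z : (S × S → (Fin d → ℝ)) × (S × S → ℝ)) :
    linForm l (tiltPot P q l w g) z =
      ∑ p, (dotp (l p) (z.1 p) - z.2 p * realLogMGF (q p.1 p.2) (l p)) +
      ∑ p, (z.2 p * w p - (∑ y, z.2 (p.1, y)) * P p.1 p.2 * (Real.exp (w p) - 1)) +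
      ∑ x, g x * (∑ y, z.2 (y, x) - ∑ y, z.2 (x, y)) := by
  have h1 : ∑ p : S × S, z.2 p * (∑ y, P p.1 y * (Real.exp (w (p.1, y)) - 1)) =
      ∑ p : S × S, (∑ y, z.2 (p.1, y)) * P p.1 p.2 * (Real.exp (w p) - 1) := by
    rw [Fintype.sum_prod_type, Fintype.sum_prod_type]
    refine Finset.sum_congr rfl fun x _ => ?_
    simp only [← Finset.sum_mul, mul_assoc, ← Finset.mul_sum]
  have h2 : ∑ p : S × S, z.2 p * g p.2 = ∑ x, g x * ∑ y, z.2 (y, x) := by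
    rw [Fintype.sum_prod_type_right]
    refine Finset.sum_congr rfl fun x _ => ?_
    rw [Finset.mul_sum]
    exact Finset.sum_congr rfl fun y _ => mul_comm _ _
  have h3 : ∑ p : S × S, z.2 p * g p.1 = ∑ x, g x * ∑ y, z.2 (x, y) := by
    rw [Fintype.sum_prod_type]
    refine Finset.sum_congr rfl fun x _ => ?_
    rw [Finset.mul_sum]
    exact Finset.sum_congr rfl fun y _ => mul_comm _ _
  simp only [mul_sub (g _), Finset.sum_sub_distrib, ← h1, ← h2, ← h3]
  simp only [← Finset.sum_sub_distrib, ← Finset.sum_add_distrib, linForm, tiltPot]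
  refine Finset.sum_congr rfl fun p _ => by ring

variable {P : S → S → ℝ} {q : S → S → Measure (Fin d → ℝ)}

theorem rateI_eq_top {z : (S × S → (Fin d → ℝ)) × (S × S → ℝ)}
    (hz : z.2 ∉ stdSimplex ℝ (S × S)) : rateI P q z.1 z.2 = ⊤ :=
  if_neg fun h => hz h.2.2

variable [∀ x y, IsProbabilityMeasure (q x y)]

theorem linForm_tiltPot_le_rateI (hq : ∀ x y, ExpMoments (q x y)) (l : S × S → (Fin d → ℝ))
    (w : S × S → ℝ) (g : S → ℝ) (z : (S × S → (Fin d → ℝ)) × (S × S → ℝ)) :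
    (linForm l (tiltPot P q l w g) z : EReal) ≤ rateI P q z.1 z.2 := by
  unfold rateI
  split_ifs with h
  swap
  · exact le_top
  obtain ⟨hk, hb, hθ⟩ := h
  rw [linForm_tiltPot, Finset.sum_eq_zero (s := Finset.univ)
    (f := fun x => g x * (∑ y, z.2 (y, x) - ∑ y, z.2 (x, y))) fun x _ => by rw [hb x]; ring,
    add_zero, EReal.coe_add, EReal.coe_sum_finset, EReal.coe_sum_finset]
  exact add_le_add
    (Finset.sum_le_sum fun p _ => le_mul_cramerTransform (hq _ _) (hθ.1 p) (hk p) _)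
    (Finset.sum_le_sum fun p _ => sEnt_ge _ _ _)

theorem exists_lt_linForm_tiltPot_of_not_absCont
    {z : (S × S → (Fin d → ℝ)) × (S × S → ℝ)} (hk : ¬ ∀ p, z.2 p = 0 → z.1 p = 0) (α : ℝ) :
    ∃ l w g, α < linForm l (tiltPot P q l w g) z := by
  simp only [linForm_tiltPot]
  push Not at hk
  obtain ⟨p, hp0, hp⟩ := hk
  refine ⟨Pi.single p (((|α| + 1) / dotp (z.1 p) (z.1 p)) • z.1 p), 0, 0, ?_⟩
  rw [Finset.sum_eq_single p]
  · have := dotp_self_pos hp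
    simp only [Pi.single_eq_same, dotp_smul_left, hp0]
    rw [div_mul_cancel₀ _ this.ne']
    simp
    linarith [le_abs_self α]
  · intro p' _ hp'
    rw [Pi.single_eq_of_ne hp', dotp_zero_left, realLogMGF_zero]
    simp
  · simp

theorem exists_lt_linForm_tiltPot_of_not_balanced
    {z : (S × S → (Fin d → ℝ)) × (S × S → ℝ)}
    (hb : ¬ ∀ x, ∑ y, z.2 (x, y) = ∑ y, z.2 (y, x)) (α : ℝ) :
    ∃ l w g, α < linForm l (tiltPot P q l w g) z := by
  simp only [linForm_tiltPot]
  push Not at hb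
  obtain ⟨x, hx⟩ := hb
  have hx' : ∑ y, z.2 (y, x) - ∑ y, z.2 (x, y) ≠ 0 := sub_ne_zero.2 hx.symm
  refine ⟨0, 0, Pi.single x ((|α| + 1) / (∑ y, z.2 (y, x) - ∑ y, z.2 (x, y))), ?_⟩
  rw [Finset.sum_eq_single (s := Finset.univ)
    (f := fun x' => (Pi.single x _ : S → ℝ) x' * (_ - _)) x]
  · rw [Pi.single_eq_same, div_mul_cancel₀ _ hx']
    simp [dotp_zero_left, realLogMGF_zero]
    linarith [le_abs_self α]
  · intro x' _ hx'
    rw [Pi.single_eq_of_ne hx', zero_mul]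
  · simp
theorem exists_lt_linForm_tiltPot (hP : ∀ x y, 0 ≤ P x y) (hq : ∀ x y, ExpMoments (q x y))
    {z : (S × S → (Fin d → ℝ)) × (S × S → ℝ)} (hz : z.2 ∈ stdSimplex ℝ (S × S)) {α : ℝ}
    (h : (α : EReal) < rateI P q z.1 z.2) :
    ∃ l w g, α < linForm l (tiltPot P q l w g) z := by
  by_cases hk : ∀ p, z.2 p = 0 → z.1 p = 0
  swap
  · exact exists_lt_linForm_tiltPot_of_not_absCont hk α
  by_cases hb : ∀ x, ∑ y, z.2 (x, y) = ∑ y, z.2 (y, x)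
  swap
  · exact exists_lt_linForm_tiltPot_of_not_balanced hb α
  simp only [linForm_tiltPot]
  rw [rateI, if_pos ⟨hk, hb, hz⟩] at h
  have hA : ∀ p : S × S, (0 : EReal) ≤
      (z.2 p : EReal) * cramerTransform (q p.1 p.2) ((z.2 p)⁻¹ • z.1 p) := fun p =>
    mul_cramerTransform_nonneg (hq _ _) (hz.1 p) (hk p)
  obtain ⟨r, s, hr, hs, hrs⟩ := EReal.coe_lt_add_exists (Finset.sum_nonneg fun p _ => hA p)
    (Finset.sum_nonneg fun p _ => sEnt_nonneg _ _) h
  obtain ⟨fr, hfr, hr⟩ := EReal.coe_lt_sum_exists _ hA hr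
  obtain ⟨fs, hfs, hs⟩ := EReal.coe_lt_sum_exists _ (fun p => sEnt_nonneg _ _) hs
  have hl : ∀ p, ∃ l, fr p < dotp l (z.1 p) - z.2 p * realLogMGF (q p.1 p.2) l := fun p =>
    exists_lt_of_lt_mul_cramerTransform (hq p.1 p.2) (hz.1 p) (hfr p (Finset.mem_univ p))
  have hw : ∀ p, ∃ w, fs p < z.2 p * w - (∑ y, z.2 (p.1, y)) * P p.1 p.2 * (Real.exp w - 1) :=
    fun p => exists_lt_of_lt_sEnt (hz.1 p)
      (mul_nonneg (Finset.sum_nonneg fun y _ => hz.1 _) (hP _ _)) (hfs p (Finset.mem_univ p))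
  choose l hl using hl
  choose w hw using hw
  refine ⟨l, w, 0, ?_⟩
  have h1 := Finset.sum_le_sum (s := Finset.univ) fun p _ => (hl p).le
  have h2 := Finset.sum_le_sum (s := Finset.univ) fun p _ => (hw p).le
  simp only [Pi.zero_apply, zero_mul, Finset.sum_const_zero, add_zero]
  linarith

theorem rateI_nonneg (hq : ∀ x y, ExpMoments (q x y))
    (z : (S × S → (Fin d → ℝ)) × (S × S → ℝ)) : 0 ≤ rateI P q z.1 z.2 := by
  have h := linForm_tiltPot_le_rateI (P := P) hq 0 0 0 z
  rw [linForm_tiltPot] at h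
  simpa [dotp_zero_left, realLogMGF_zero] using h

end RateFunction

section ExponentialRates

theorem inv_mul_log_exp {n : ℕ} (hn : n ≠ 0) (b c : ℝ) :
    (((n : ℝ)⁻¹ : ℝ) : EReal) * ENNReal.log (ENNReal.ofReal (Real.exp (b - n * c))) =
      (((n : ℝ)⁻¹ * b - c : ℝ) : EReal) := by
  rw [ENNReal.log_ofReal_of_pos (Real.exp_pos _), Real.log_exp, ← EReal.coe_mul]
  congr 1
  field_simp

theorem tendsto_inv_mul_sub (b c : ℝ) :
    Tendsto (fun n : ℕ => (((n : ℝ)⁻¹ * b - c : ℝ) : EReal)) atTop (nhds ((-c : ℝ) : EReal)) := by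
  refine (continuous_coe_real_ereal.tendsto _).comp ?_
  have h := ((tendsto_inv_atTop_nhds_zero_nat (𝕜 := ℝ)).mul_const b).sub_const c
  simpa using h

theorem limsup_inv_mul_log_le {u : ℕ → ℝ≥0∞} {D : ℝ≥0∞} (hD : D ≠ ⊤) {c : ℝ}
    (h : ∀ᶠ n : ℕ in atTop, u n ≤ D * ENNReal.ofReal (Real.exp (-(n * c)))) :
    limsup (fun n : ℕ => (((n : ℝ)⁻¹ : ℝ) : EReal) * ENNReal.log (u n)) atTop ≤
      ((-c : ℝ) : EReal) := by
  obtain ⟨b, hb⟩ : ∃ b : ℝ, D ≤ ENNReal.ofReal (Real.exp b) := by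
    refine ⟨D.toReal, ?_⟩
    rw [← ENNReal.ofReal_toReal hD, ENNReal.toReal_ofReal ENNReal.toReal_nonneg]
    exact ENNReal.ofReal_le_ofReal (by linarith [Real.add_one_le_exp D.toReal])
  rw [← (tendsto_inv_mul_sub b c).limsup_eq]
  refine limsup_le_limsup ?_
  filter_upwards [h, eventually_ne_atTop 0] with n hn hn0
  rw [← inv_mul_log_exp hn0]
  refine mul_le_mul_of_nonneg_left (ENNReal.log_le_log ?_) (EReal.coe_nonneg.2 (by positivity))
  rw [sub_eq_add_neg, ofReal_exp_add]
  exact hn.trans (mul_le_mul_left hb _)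

theorem le_liminf_inv_mul_log {u : ℕ → ℝ≥0∞} {δ : ℝ≥0∞} (hδ : δ ≠ 0) {c : ℝ}
    (h : ∀ᶠ n : ℕ in atTop, δ * ENNReal.ofReal (Real.exp (-(n * c))) ≤ u n) :
    ((-c : ℝ) : EReal) ≤
      liminf (fun n : ℕ => (((n : ℝ)⁻¹ : ℝ) : EReal) * ENNReal.log (u n)) atTop := by
  obtain ⟨b, hb⟩ : ∃ b : ℝ, ENNReal.ofReal (Real.exp b) ≤ δ := by
    rcases eq_or_ne δ ⊤ with rfl | htop
    · exact ⟨0, le_top⟩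
    · exact ⟨Real.log δ.toReal, by
        rw [Real.exp_log (ENNReal.toReal_pos hδ htop), ENNReal.ofReal_toReal htop]⟩
  rw [← (tendsto_inv_mul_sub b c).liminf_eq]
  refine liminf_le_liminf ?_
  filter_upwards [h, eventually_ne_atTop 0] with n hn hn0
  rw [← inv_mul_log_exp hn0]
  refine mul_le_mul_of_nonneg_left (ENNReal.log_le_log ?_) (EReal.coe_nonneg.2 (by positivity))
  rw [sub_eq_add_neg, ofReal_exp_add]
  exact (mul_le_mul_left hb _).trans hn

end ExponentialRates

section GoodRate

variable {S : Type*} [Fintype S] {d : ℕ}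

/-- The continuous linear minorant of the rate function with dual parameters
`t = (l, w, g)`. -/
def tilt (P : S → S → ℝ) (q : S → S → Measure (Fin d → ℝ))
    (t : (S × S → (Fin d → ℝ)) × (S × S → ℝ) × (S → ℝ))
    (z : (S × S → (Fin d → ℝ)) × (S × S → ℝ)) : ℝ :=
  linForm t.1 (tiltPot P q t.1 t.2.1 t.2.2) z

/-- The dual parameter probing the `i`-th coordinate of the flux through `p`. -/
def coordTilt (j : (S × S) × Fin d) (σ : ℝ) : (S × S → (Fin d → ℝ)) × (S × S → ℝ) × (S → ℝ) :=
  (Pi.single j.1 (Pi.single j.2 σ), 0, 0)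

variable {P : S → S → ℝ} {q : S → S → Measure (Fin d → ℝ)}

theorem continuous_tilt (t : (S × S → (Fin d → ℝ)) × (S × S → ℝ) × (S → ℝ)) :
    Continuous (tilt P q t) := continuous_linForm _ _

theorem isClosed_snd_mem_stdSimplex :
    IsClosed {z : (S × S → (Fin d → ℝ)) × (S × S → ℝ) | z.2 ∈ stdSimplex ℝ (S × S)} :=
  (isClosed_stdSimplex _ _).preimage continuous_snd

variable [∀ x y, IsProbabilityMeasure (q x y)]

theorem tilt_coordTilt (j : (S × S) × Fin d) (σ : ℝ)
    (z : (S × S → (Fin d → ℝ)) × (S × S → ℝ)) :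
    tilt P q (coordTilt j σ) z =
      σ * z.1 j.1 j.2 - z.2 j.1 * realLogMGF (q j.1.1 j.1.2) (Pi.single j.2 σ) := by
  rw [tilt, coordTilt, linForm_tiltPot, Finset.sum_eq_single j.1]
  · simp [dotp, Pi.single_apply]
  · intro p _ hp
    dsimp only
    rw [Pi.single_eq_of_ne hp, dotp_zero_left, realLogMGF_zero]
    simp
  · simp

theorem isCompact_coercive (α : ℝ) :
    IsCompact {z : (S × S → (Fin d → ℝ)) × (S × S → ℝ) | z.2 ∈ stdSimplex ℝ (S × S) ∧
      ∀ j, tilt P q (coordTilt j 1) z ≤ α ∧ tilt P q (coordTilt j (-1)) z ≤ α} := by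
  let B : S × S → Fin d → ℝ := fun p i => |α| + |realLogMGF (q p.1 p.2) (Pi.single i 1)| +
    |realLogMGF (q p.1 p.2) (Pi.single i (-1))|
  have hK : IsCompact ((Set.univ.pi fun p => Set.univ.pi fun i => Set.Icc (-B p i) (B p i)) ×ˢ
      stdSimplex ℝ (S × S)) :=
    (isCompact_univ_pi fun p => isCompact_univ_pi fun i => isCompact_Icc).prod
      (isCompact_stdSimplex _ _)
  refine hK.of_isClosed_subset ?_ ?_
  · rw [Set.ofPred_and, Set.ofPred_forall]
    refine isClosed_snd_mem_stdSimplex.inter ?_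
    exact isClosed_iInter fun j => (isClosed_le (continuous_tilt _) continuous_const).inter
      (isClosed_le (continuous_tilt _) continuous_const)
  · rintro z ⟨hz, hj⟩
    refine ⟨fun p _ i _ => ?_, hz⟩
    obtain ⟨h1, h2⟩ := hj (p, i)
    rw [tilt_coordTilt] at h1 h2
    have hb : ∀ φ : ℝ, z.2 p * φ ≤ |φ| := fun φ => by
      have h0 := hz.1 p
      have h1 : z.2 p ≤ 1 := (Finset.single_le_sum (fun p _ => hz.1 p)
        (Finset.mem_univ p)).trans hz.2.le
      nlinarith [le_abs_self φ, abs_nonneg φ]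
    have hb1 := hb (realLogMGF (q p.1 p.2) (Pi.single i 1))
    have hb2 := hb (realLogMGF (q p.1 p.2) (Pi.single i (-1)))
    constructor <;>
    · simp only [B]
      dsimp only at h1 h2
      linarith [le_abs_self α, abs_nonneg (realLogMGF (q p.1 p.2) (Pi.single i 1)),
        abs_nonneg (realLogMGF (q p.1 p.2) (Pi.single i (-1)))]

theorem lowerSemicontinuous_rateI (hP : ∀ x y, 0 ≤ P x y) (hq : ∀ x y, ExpMoments (q x y)) :
    LowerSemicontinuous (fun z : (S × S → (Fin d → ℝ)) × (S × S → ℝ) => rateI P q z.1 z.2) := by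
  intro z y hy
  by_cases hz : z.2 ∈ stdSimplex ℝ (S × S)
  · obtain ⟨α, hyα, hα⟩ := EReal.lt_iff_exists_real_btwn.1 hy
    obtain ⟨l, w, g, h⟩ := exists_lt_linForm_tiltPot hP hq hz hα
    filter_upwards [(continuous_linForm _ _).continuousAt.eventually_const_lt h] with z' hz'
    exact hyα.trans_le ((EReal.coe_le_coe_iff.2 hz'.le).trans (linForm_tiltPot_le_rateI hq _ _ _ _))
  · filter_upwards [isClosed_snd_mem_stdSimplex.isOpen_compl.mem_nhds hz] with z' hz'
    refine lt_of_lt_of_eq (b := (⊤ : EReal)) ?_ (rateI_eq_top hz').symm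
    exact lt_of_lt_of_eq hy (rateI_eq_top hz)

theorem isCompact_rateI_le (hP : ∀ x y, 0 ≤ P x y) (hq : ∀ x y, ExpMoments (q x y)) (c : ℝ) :
    IsCompact {z : (S × S → (Fin d → ℝ)) × (S × S → ℝ) | rateI P q z.1 z.2 ≤ (c : EReal)} := by
  refine (isCompact_coercive (P := P) (q := q) c).of_isClosed_subset
    ((lowerSemicontinuous_rateI hP hq).isClosed_preimage (c : EReal)) fun z hz => ⟨?_, fun j => ?_⟩
  · by_contra hz'
    have h : rateI P q z.1 z.2 ≤ (c : EReal) := hz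
    rw [rateI_eq_top hz'] at h
    exact absurd h (not_le.2 (EReal.coe_lt_top c))
  · exact ⟨EReal.coe_le_coe_iff.1 ((linForm_tiltPot_le_rateI hq _ _ _ z).trans hz),
      EReal.coe_le_coe_iff.1 ((linForm_tiltPot_le_rateI hq _ _ _ z).trans hz)⟩

/-- Chebyshev's inequality with finitely many tilts gives the upper bound for closed sets. -/
theorem limsup_le_neg_iInf_rateI (hP : ∀ x y, 0 ≤ P x y) (hq : ∀ x y, ExpMoments (q x y))
    {Ω : Type*} [MeasurableSpace Ω] (μ : Measure Ω)
    (Z : ℕ → Ω → (S × S → (Fin d → ℝ)) × (S × S → ℝ)) (hZ : ∀ n, Measurable (Z n))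
    (hsimp : ∀ n ≠ 0, ∀ ω, (Z n ω).2 ∈ stdSimplex ℝ (S × S))
    (hC : ∀ t, ∃ C : ℝ≥0∞, C ≠ ⊤ ∧
      ∀ n ≠ 0, ∫⁻ ω, ENNReal.ofReal (Real.exp (n * tilt P q t (Z n ω))) ∂μ ≤ C)
    {F : Set ((S × S → (Fin d → ℝ)) × (S × S → ℝ))} (hF : IsClosed F) :
    limsup (fun n : ℕ => (((n : ℝ)⁻¹ : ℝ) : EReal) * ENNReal.log (μ {ω | Z n ω ∈ F})) atTop ≤
      -(⨅ z ∈ F, rateI P q z.1 z.2) := by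
  refine EReal.le_neg_of_le_neg (EReal.ge_of_forall_gt_iff_ge.1 fun α hα => ?_)
  refine EReal.le_neg_of_le_neg ?_
  rw [← EReal.coe_neg]
  choose C hCtop hC using hC
  have hK := (isCompact_coercive (P := P) (q := q) α).inter_right hF
  have hcover : ∀ z ∈ {z : (S × S → (Fin d → ℝ)) × (S × S → ℝ) | z.2 ∈ stdSimplex ℝ (S × S) ∧
      ∀ j, tilt P q (coordTilt j 1) z ≤ α ∧ tilt P q (coordTilt j (-1)) z ≤ α} ∩ F,
      ∃ t, α < tilt P q t z := by
    rintro z ⟨⟨hz, -⟩, hzF⟩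
    obtain ⟨l, w, g, h⟩ := exists_lt_linForm_tiltPot hP hq hz (hα.trans_le (iInf₂_le z hzF))
    exact ⟨(l, w, g), h⟩
  obtain ⟨T, hT⟩ := hK.elim_finite_subcover (fun t => {z | α < tilt P q t z})
    (fun t => isOpen_lt continuous_const (continuous_tilt t))
    (fun z hz => Set.mem_iUnion.2 (hcover z hz))
  set T' := T ∪ (Finset.univ.image fun j => coordTilt j 1) ∪
    (Finset.univ.image fun j => coordTilt j (-1)) with hT'
  have hsub : ∀ z ∈ F, z.2 ∈ stdSimplex ℝ (S × S) → ∃ t ∈ T', α < tilt P q t z := by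
    intro z hzF hz
    by_contra! hcon
    have hmem : z ∈ ⋃ t ∈ T, {z | α < tilt P q t z} := hT ⟨⟨hz, fun j =>
      ⟨hcon _ (by simp [hT']), hcon _ (by simp [hT'])⟩⟩, hzF⟩
    simp only [Set.mem_iUnion] at hmem
    obtain ⟨t, ht, hlt⟩ := hmem
    exact absurd (hcon t (by simp [hT', ht])) (not_le.2 hlt)
  refine limsup_inv_mul_log_le (D := ∑ t ∈ T', C t) (ENNReal.sum_ne_top.2 fun t _ => hCtop t) ?_
  filter_upwards [eventually_ne_atTop 0] with n hn
  have h1 : {ω | Z n ω ∈ F} ⊆ ⋃ t ∈ T', {ω | α < tilt P q t (Z n ω)} := fun ω hω => by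
    simpa using hsub _ hω (hsimp n hn ω)
  refine (measure_mono h1).trans ((measure_biUnion_finset_le _ _).trans ?_)
  rw [Finset.sum_mul]
  refine Finset.sum_le_sum fun t _ => ?_
  have hmeas : Measurable fun ω => ENNReal.ofReal (Real.exp (n * tilt P q t (Z n ω))) :=
    (((continuous_tilt t).measurable.comp (hZ n)).const_mul _).exp.ennreal_ofReal
  have h2 := mul_meas_ge_le_lintegral (μ := μ) hmeas (ENNReal.ofReal (Real.exp (n * α)))
  have h3 : μ {ω | α < tilt P q t (Z n ω)} ≤ μ {ω | ENNReal.ofReal (Real.exp (n * α)) ≤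
      ENNReal.ofReal (Real.exp (n * tilt P q t (Z n ω)))} :=
    measure_mono fun ω (hω : α < _) => ofReal_exp_mono
      (mul_le_mul_of_nonneg_left hω.le (Nat.cast_nonneg n))
  calc μ {ω | α < tilt P q t (Z n ω)}
      = ENNReal.ofReal (Real.exp (n * α)) * μ {ω | α < tilt P q t (Z n ω)} *
          ENNReal.ofReal (Real.exp (-(n * α))) := by
        rw [mul_comm, ← mul_assoc, ← ofReal_exp_add]
        simp
    _ ≤ C t * ENNReal.ofReal (Real.exp (-(n * α))) :=
        mul_le_mul_left (((mul_le_mul_right h3 _).trans h2).trans (hC t n hn)) _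

end GoodRate

/-- If the path probabilities of a chain with increments factorise along the kernel `R`, the
summed increments are distributed according to the iterates of `R`. -/
theorem measure_sum_increments {Ω S E : Type*} [MeasurableSpace Ω] [Fintype S] [DecidableEq S]
    [MeasurableSpace S] [MeasurableSingletonClass S] [AddCommMonoid E] [MeasurableSpace E]
    [MeasurableAdd₂ E] (R : S → S → Measure E) [∀ a b, IsFiniteMeasure (R a b)]
    {X : ℕ → Ω → S} (hX : ∀ m, Measurable (X m)) {V : ℕ → Ω → E} (hV : ∀ m, Measurable (V m))
    (n : ℕ) (ρ : Measure Ω) (w : S → S → ℝ≥0∞) (hw : ∀ a b, w a b ≠ ⊤)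
    (hρ : ∀ (x : ℕ → S) (B : ℕ → Set E), (∀ m, MeasurableSet (B m)) →
      ρ ((⋂ m ∈ Finset.range (n + 1), {ω | X m ω = x m}) ∩ ⋂ m ∈ Finset.Icc 1 n, V m ⁻¹' B m) =
        w (x 0) (x n) * ∏ m ∈ Finset.Icc 1 n, R (x (m - 1)) (x m) (B m))
    (a b : S) {D : Set E} (hD : MeasurableSet D) :
    ρ ({ω | X 0 ω = a ∧ X n ω = b} ∩ {ω | ∑ m ∈ Finset.Icc 1 n, V m ω ∈ D}) =
      w a b * stepPow R n a b D := by
  induction n generalizing ρ w b D with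
  | zero =>
    by_cases hab : a = b
    · subst hab
      by_cases h0 : (0 : E) ∈ D
      · simpa [stepPow, hD, h0] using hρ (fun _ => a) (fun _ => Set.univ) (by simp)
      · simp [stepPow, hD, h0]
    · have : {ω | X 0 ω = a ∧ X 0 ω = b} = ∅ :=
        Set.eq_empty_of_forall_notMem fun ω hω => hab (hω.1.symm.trans hω.2)
      simp [stepPow, hab, this]
  | succ n ih =>
    set T : Ω → E := fun ω => ∑ m ∈ Finset.Icc 1 n, V m ω with hT
    have hTm : Measurable T := Finset.measurable_fun_sum _ fun m _ => hV m
    have hXs : ∀ m c, MeasurableSet {ω | X m ω = c} := fun m c =>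
      hX m (measurableSet_singleton c)
    have hXX : ∀ c, MeasurableSet {ω | X 0 ω = a ∧ X n ω = c} := fun c =>
      (hXs 0 a).inter (hXs n c)
    have hjoint : ∀ c, (ρ.restrict ({ω | X 0 ω = a ∧ X n ω = c} ∩ {ω | X (n + 1) ω = b})).map
        (fun ω => (T ω, V (n + 1) ω)) = (w a b • stepPow R n a c).prod (R c b) := by
      intro c
      have := (stepPow R n a c).smul_finite (hw a b)
      refine (Measure.prod_eq fun D' B hD' hB => ?_).symm
      have h1 := ih (ρ.restrict ({ω | X (n + 1) ω = b} ∩ V (n + 1) ⁻¹' B))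
        (fun u v => w u b * R v b B) (fun u v => ENNReal.mul_ne_top (hw u b) (measure_ne_top _ _))
        (fun x C hC => ?_) c hD'
      · rw [Measure.map_apply (hTm.prodMk (hV _)) (hD'.prod hB), Measure.restrict_apply
          ((hTm.prodMk (hV _)) (hD'.prod hB))]
        have hTD : MeasurableSet {ω | ∑ m ∈ Finset.Icc 1 n, V m ω ∈ D'} := hTm hD'
        rw [Measure.restrict_apply ((hXX c).inter hTD)] at h1
        rw [Measure.smul_apply, smul_eq_mul, mul_right_comm, ← h1]
        congr 1
        ext ω
        simp only [Set.mem_inter_iff, Set.mem_preimage, Set.mem_prod, Set.mem_ofPred_eq, hT]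
        tauto
      · have h2 := hρ (Function.update x (n + 1) b) (Function.update C (n + 1) B) (fun m => by
          rcases eq_or_ne m (n + 1) with rfl | hm
          · simpa using hB
          · simpa [hm] using hC m)
        have hprod : ∏ m ∈ Finset.Icc 1 (n + 1),
            R (Function.update x (n + 1) b (m - 1)) (Function.update x (n + 1) b m)
              (Function.update C (n + 1) B m) =
            (∏ m ∈ Finset.Icc 1 n, R (x (m - 1)) (x m) (C m)) * R (x n) b B := by
          rw [Finset.prod_Icc_succ_top (by omega)]
          congr 1
          · refine Finset.prod_congr rfl fun m hm => ?_
            rw [Finset.mem_Icc] at hm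
            rw [Function.update_of_ne (by omega), Function.update_of_ne (by omega),
              Function.update_of_ne (by omega)]
          · simp
        rw [hprod, Function.update_of_ne (by omega), Function.update_self] at h2
        rw [mul_right_comm, mul_assoc (w _ _), ← h2, Measure.restrict_apply]
        · congr 1
          ext ω
          simp only [Set.mem_inter_iff, Set.mem_iInter, Finset.mem_range, Finset.mem_Icc,
            Set.mem_preimage, Set.mem_ofPred_eq]
          constructor
          · rintro ⟨⟨h3, h4⟩, h5, h6⟩
            refine ⟨fun m hm => ?_, fun m hm => ?_⟩
            · rcases eq_or_ne m (n + 1) with rfl | hm'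
              · simpa using h5
              · simpa [hm'] using h3 m (by omega)
            · rcases eq_or_ne m (n + 1) with rfl | hm'
              · simpa using h6
              · simpa [hm'] using h4 m (by omega)
          · rintro ⟨h3, h4⟩
            refine ⟨⟨fun m hm => ?_, fun m hm => ?_⟩, ?_, ?_⟩
            · simpa [show m ≠ n + 1 by omega] using h3 m (by omega)
            · simpa [show m ≠ n + 1 by omega] using h4 m (by omega)
            · simpa using h3 (n + 1) (by omega)
            · simpa using h4 (n + 1) (by omega)
        · exact (Finset.measurableSet_biInter _ fun m _ => hXs m _).inter
            (Finset.measurableSet_biInter _ fun m _ => hV m (hC m))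
    have hsplit : {ω | X 0 ω = a ∧ X (n + 1) ω = b} ∩
        {ω | ∑ m ∈ Finset.Icc 1 (n + 1), V m ω ∈ D} = ⋃ c ∈ (Finset.univ : Finset S),
        (fun ω => T ω + V (n + 1) ω) ⁻¹' D ∩
          ({ω | X 0 ω = a ∧ X n ω = c} ∩ {ω | X (n + 1) ω = b}) := by
      ext ω
      simp only [Set.mem_inter_iff, Set.mem_iUnion, Finset.mem_univ, Set.mem_preimage,
        Set.mem_ofPred_eq, Finset.sum_Icc_succ_top (show 1 ≤ n + 1 by omega), hT, exists_prop,
        true_and]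
      constructor
      · rintro ⟨⟨h1, h2⟩, h3⟩
        exact ⟨X n ω, h3, ⟨h1, rfl⟩, h2⟩
      · rintro ⟨c, h3, ⟨h1, -⟩, h2⟩
        exact ⟨⟨h1, h2⟩, h3⟩
    have hmeas : MeasurableSet ((fun ω => T ω + V (n + 1) ω) ⁻¹' D) := (hTm.add (hV _)) hD
    rw [hsplit, measure_biUnion_finset, stepPow_succ, Measure.finsetSum_apply, Finset.mul_sum]
    · refine Finset.sum_congr rfl fun c _ => ?_
      rw [← Measure.restrict_apply hmeas, Measure.conv, Measure.map_apply measurable_add hD,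
        ← smul_eq_mul, ← Measure.smul_apply, ← Measure.prod_smul_left, ← hjoint c,
        Measure.map_apply (hTm.prodMk (hV _)) (measurable_add hD)]
      rfl
    · intro c _ c' _ hcc
      refine Set.disjoint_left.2 fun ω h1 h2 => hcc ?_
      exact h1.2.1.2.symm.trans h2.2.1.2
    · exact fun c _ => hmeas.inter ((hXX c).inter (hXs _ b))

theorem measurable_ofReal_exp_linForm {S : Type*} [Fintype S] {d : ℕ}
    (l : S × S → (Fin d → ℝ)) (u : S × S → ℝ) :
    Measurable fun s => ENNReal.ofReal (Real.exp (linForm l u s)) :=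
  (continuous_linForm l u).measurable.exp.ennreal_ofReal

section EdgeKernel

variable {S : Type*} [DecidableEq S] {d : ℕ}

/-- The unnormalised contribution to `(k, θ)` of one step from `x` to `y` with increment `a`. -/
def edgeIncr (x y : S) (a : Fin d → ℝ) : (S × S → (Fin d → ℝ)) × (S × S → ℝ) :=
  (Pi.single (x, y) a, Pi.single (x, y) 1)

/-- The joint law of a step from `x` to `y` and of its contribution to `(k, θ)`. -/
def edgeKernel (P : S → S → ℝ) (q : S → S → Measure (Fin d → ℝ)) (x y : S) :
    Measure ((S × S → (Fin d → ℝ)) × (S × S → ℝ)) :=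
  ENNReal.ofReal (P x y) • (q x y).map (edgeIncr x y)

theorem measurable_edgeIncr (x y : S) :
    Measurable (edgeIncr x y : (Fin d → ℝ) → (S × S → (Fin d → ℝ)) × (S × S → ℝ)) := by
  refine Measurable.prodMk ?_ measurable_const
  refine measurable_pi_lambda _ fun p => ?_
  rcases eq_or_ne p (x, y) with rfl | hp
  · simpa using measurable_id'
  · simp [Pi.single_eq_of_ne hp]

variable {P : S → S → ℝ} {q : S → S → Measure (Fin d → ℝ)}

theorem edgeKernel_apply (x y : S) {B : Set ((S × S → (Fin d → ℝ)) × (S × S → ℝ))}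
    (hB : MeasurableSet B) :
    edgeKernel P q x y B = ENNReal.ofReal (P x y) * q x y (edgeIncr x y ⁻¹' B) := by
  rw [edgeKernel, Measure.smul_apply, Measure.map_apply (measurable_edgeIncr x y) hB, smul_eq_mul]

theorem lintegral_edgeKernel (x y : S) {F : (S × S → (Fin d → ℝ)) × (S × S → ℝ) → ℝ≥0∞}
    (hF : Measurable F) :
    ∫⁻ s, F s ∂(edgeKernel P q x y) = ENNReal.ofReal (P x y) * ∫⁻ a, F (edgeIncr x y a) ∂(q x y) := by
  rw [edgeKernel, lintegral_smul_measure, lintegral_map hF (measurable_edgeIncr x y), smul_eq_mul]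

variable [∀ x y, IsProbabilityMeasure (q x y)]

instance edgeKernel_isFiniteMeasure (x y : S) : IsFiniteMeasure (edgeKernel P q x y) :=
  (Measure.map (edgeIncr x y) (q x y)).smul_finite ENNReal.ofReal_ne_top

theorem edgeKernel_univ (x y : S) : edgeKernel P q x y Set.univ = ENNReal.ofReal (P x y) := by
  rw [edgeKernel_apply x y MeasurableSet.univ, Set.preimage_univ, measure_univ, mul_one]

variable [Fintype S]

theorem linForm_edgeIncr (l : S × S → (Fin d → ℝ)) (u : S × S → ℝ) (x y : S) (a : Fin d → ℝ) :
    linForm l u (edgeIncr x y a) = dotp (l (x, y)) a + u (x, y) := by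
  rw [linForm, Finset.sum_eq_single (x, y)]
  · simp [edgeIncr]
  · intro p _ hp
    simp [edgeIncr, Pi.single_eq_of_ne hp, dotp_zero_right]
  · simp

theorem lintegral_exp_linForm_edgeKernel (hP : ∀ x y, 0 ≤ P x y)
    (hq : ∀ x y, ExpMoments (q x y)) (l : S × S → (Fin d → ℝ)) (u : S × S → ℝ) (x y : S) :
    ∫⁻ s, ENNReal.ofReal (Real.exp (linForm l u s)) ∂(edgeKernel P q x y) =
      ENNReal.ofReal (P x y * Real.exp (realLogMGF (q x y) (l (x, y)) + u (x, y))) := by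
  rw [lintegral_edgeKernel x y (measurable_ofReal_exp_linForm l u)]
  simp only [linForm_edgeIncr, ofReal_exp_add]
  rw [lintegral_mul_const _ (continuous_dotp _).measurable.exp.ennreal_ofReal,
    (lintegral_exp_dotp (hq x y) _).1, ← ofReal_exp_add, ENNReal.ofReal_mul (hP x y)]

theorem lintegral_exp_linForm_stepPow (l : S × S → (Fin d → ℝ)) (u : S × S → ℝ) (n : ℕ) (a b : S) :
    ∫⁻ s, ENNReal.ofReal (Real.exp (linForm l u s)) ∂(stepPow (edgeKernel P q) n a b) =
      ((Matrix.of fun x y => ∫⁻ s, ENNReal.ofReal (Real.exp (linForm l u s))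
        ∂(edgeKernel P q x y)) ^ n : Matrix S S ℝ≥0∞) a b := by
  refine lintegral_stepPow _ n a b (measurable_ofReal_exp_linForm l u) ?_ fun s t => ?_
  · simp [linForm_zero]
  · rw [linForm_add, ofReal_exp_add]

theorem stepPow_edgeKernel_univ (n : ℕ) (a b : S) :
    stepPow (edgeKernel P q) n a b Set.univ =
      ((Matrix.of fun x y => ENNReal.ofReal (P x y)) ^ n : Matrix S S ℝ≥0∞) a b := by
  have h := lintegral_stepPow (edgeKernel P q) n a b (F := fun _ => 1) measurable_const rfl
    (by simp)
  simpa [edgeKernel_univ] using h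

/-- A strictly positive subharmonic vector bounds the entries of all powers of a matrix. -/
theorem Matrix_pow_mul_le_of_subinvariant {M : Matrix S S ℝ≥0∞} {h : S → ℝ≥0∞}
    (hM : ∀ x, ∑ y, M x y * h y ≤ h x) (n : ℕ) (a : S) : ∑ b, (M ^ n) a b * h b ≤ h a := by
  induction n with
  | zero => simp [Matrix.one_apply]
  | succ n ih =>
    refine le_trans (le_of_eq_of_le ?_ (Finset.sum_le_sum fun c _ =>
      mul_le_mul_right (hM c) ((M ^ n) a c))) ih
    simp only [pow_succ, Matrix.mul_apply, Finset.sum_mul, Finset.mul_sum, ← mul_assoc]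
    exact Finset.sum_comm

theorem lintegral_exp_tilt_stepPow_le (hP : ∀ x y, 0 ≤ P x y) (hP1 : ∀ x, ∑ y, P x y = 1)
    (hq : ∀ x y, ExpMoments (q x y))
    (t : (S × S → (Fin d → ℝ)) × (S × S → ℝ) × (S → ℝ)) (n : ℕ) (a b : S) :
    ∫⁻ s, ENNReal.ofReal (Real.exp (tilt P q t s)) ∂(stepPow (edgeKernel P q) n a b) ≤
      ENNReal.ofReal (Real.exp (t.2.2 b - t.2.2 a)) := by
  obtain ⟨l, w, g⟩ := t
  simp only [tilt]
  rw [lintegral_exp_linForm_stepPow]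
  set M : Matrix S S ℝ≥0∞ := Matrix.of fun x y => ∫⁻ s, ENNReal.ofReal
    (Real.exp (linForm l (tiltPot P q l w g) s)) ∂(edgeKernel P q x y) with hM
  have hrow : ∀ x, ∑ y, M x y * ENNReal.ofReal (Real.exp (-g y)) ≤
      ENNReal.ofReal (Real.exp (-g x)) := by
    intro x
    have h1 : ∀ y, M x y * ENNReal.ofReal (Real.exp (-g y)) = ENNReal.ofReal (P x y *
        Real.exp (w (x, y)) * (Real.exp (-g x) *
          Real.exp (-∑ y, P x y * (Real.exp (w (x, y)) - 1)))) := by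
      intro y
      rw [hM, Matrix.of_apply, lintegral_exp_linForm_edgeKernel hP hq,
        ← ENNReal.ofReal_mul (mul_nonneg (hP x y) (Real.exp_pos _).le), mul_assoc, mul_assoc,
        ← Real.exp_add, ← Real.exp_add, ← Real.exp_add]
      congr 3
      simp only [tiltPot]
      ring
    simp only [h1]
    rw [← ENNReal.ofReal_sum_of_nonneg fun y _ => mul_nonneg
      (mul_nonneg (hP x y) (Real.exp_pos _).le) (by positivity), ← Finset.sum_mul]
    refine ENNReal.ofReal_le_ofReal ?_
    have h2 : ∑ y, P x y * (Real.exp (w (x, y)) - 1) =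
        ∑ y, P x y * Real.exp (w (x, y)) - 1 := by
      simp only [mul_sub, Finset.sum_sub_distrib, mul_one, hP1]
    rw [h2]
    set m := ∑ y, P x y * Real.exp (w (x, y))
    have h3 : m ≤ Real.exp (m - 1) := by linarith [Real.add_one_le_exp (m - 1)]
    calc m * (Real.exp (-g x) * Real.exp (-(m - 1)))
        ≤ Real.exp (m - 1) * (Real.exp (-g x) * Real.exp (-(m - 1))) := by gcongr
      _ = Real.exp (-g x) := by
        rw [← Real.exp_add, ← Real.exp_add]
        congr 1
        ring
  have h4 := (Finset.single_le_sum (f := fun b => (M ^ n) a b * ENNReal.ofReal (Real.exp (-g b)))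
    (fun _ _ => zero_le) (Finset.mem_univ b)).trans (Matrix_pow_mul_le_of_subinvariant hrow n a)
  calc (M ^ n) a b = (M ^ n) a b * ENNReal.ofReal (Real.exp (-g b)) *
        ENNReal.ofReal (Real.exp (g b)) := by
        rw [mul_assoc, ← ofReal_exp_add]
        simp
    _ ≤ ENNReal.ofReal (Real.exp (-g a)) * ENNReal.ofReal (Real.exp (g b)) :=
        mul_le_mul_left h4 _
    _ = ENNReal.ofReal (Real.exp (g b - g a)) := by
        rw [← ofReal_exp_add, neg_add_eq_sub]

end EdgeKernel

section LoopRate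

variable {S : Type*} [Fintype S] [DecidableEq S] {d : ℕ}

theorem exists_eq_linForm (f : ((S × S → (Fin d → ℝ)) × (S × S → ℝ)) →L[ℝ] ℝ) :
    ∃ l u, ∀ z, f z = linForm l u z := by
  refine ⟨fun p i => f (Pi.single p (Pi.single i 1), 0), fun p => f (0, Pi.single p 1),
    fun z => ?_⟩
  have hz : z = ∑ p, ((∑ i, z.1 p i • ((Pi.single p (Pi.single i 1), 0) :
      (S × S → (Fin d → ℝ)) × (S × S → ℝ))) + z.2 p • (0, Pi.single p 1)) := by
    refine Prod.ext ?_ ?_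
    · ext p i
      simp [Prod.fst_sum, Finset.sum_apply, Pi.single_apply, Finset.sum_ite_eq, ite_apply]
    · ext p
      simp [Prod.snd_sum, Finset.sum_apply, Pi.single_apply, Finset.sum_ite_eq]
  conv_lhs => rw [hz]
  simp only [map_sum, map_add, map_smul, smul_eq_mul, linForm, dotp]
  simp only [mul_comm]

theorem norm_edgeIncr_le (x y : S) (a : Fin d → ℝ) : ‖edgeIncr x y a‖ ≤ l1norm a + 1 := by
  have h0 := l1norm_nonneg a
  refine max_le ?_ ?_
  · refine (pi_norm_le_iff_of_nonneg (by positivity)).2 fun p => ?_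
    rcases eq_or_ne p (x, y) with rfl | hp
    · refine (pi_norm_le_iff_of_nonneg (by positivity)).2 fun i => ?_
      have h1 : |a i| ≤ l1norm a := Finset.single_le_sum (f := fun i => |a i|)
        (fun _ _ => abs_nonneg _) (Finset.mem_univ i)
      simp only [edgeIncr, Pi.single_eq_same, Real.norm_eq_abs]
      linarith
    · simp only [edgeIncr, Pi.single_eq_of_ne hp, norm_zero]
      positivity
  · refine (pi_norm_le_iff_of_nonneg (by positivity)).2 fun p => ?_
    rcases eq_or_ne p (x, y) with rfl | hp
    · simpa [edgeIncr] using h0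
    · simp only [edgeIncr, Pi.single_eq_of_ne hp, norm_zero]
      positivity

variable {P : S → S → ℝ} {q : S → S → Measure (Fin d → ℝ)}

theorem exists_lintegral_exp_norm_edgeKernel_le (hq : ∀ x y, ExpMoments (q x y)) (κ : ℝ) :
    ∃ C : ℝ≥0∞, C ≠ ⊤ ∧
      ∀ x y, ∫⁻ s, ENNReal.ofReal (Real.exp (κ * ‖s‖)) ∂(edgeKernel P q x y) ≤ C := by
  refine ⟨∑ x, ∑ y, ∫⁻ s, ENNReal.ofReal (Real.exp (κ * ‖s‖)) ∂(edgeKernel P q x y),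
    ENNReal.sum_ne_top.2 fun x _ => ENNReal.sum_ne_top.2 fun y _ => ?_, fun x y => ?_⟩
  · rw [lintegral_edgeKernel x y (by fun_prop)]
    refine ENNReal.mul_ne_top ENNReal.ofReal_ne_top (ne_top_of_le_ne_top
      (ENNReal.mul_ne_top (hq x y |κ|) (ENNReal.ofReal_ne_top (r := Real.exp |κ|))) ?_)
    rw [← lintegral_mul_const _ (measurable_l1norm.const_mul _).exp.ennreal_ofReal]
    refine lintegral_mono fun a => ?_
    rw [← ofReal_exp_add]
    refine ofReal_exp_mono ?_
    have h1 := norm_edgeIncr_le x y a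
    nlinarith [le_abs_self κ, abs_nonneg κ, norm_nonneg (edgeIncr x y a)]
  · exact (Finset.single_le_sum (f := fun y => ∫⁻ s, ENNReal.ofReal (Real.exp (κ * ‖s‖))
      ∂(edgeKernel P q x y)) (fun _ _ => zero_le) (Finset.mem_univ y)).trans
      (Finset.single_le_sum (f := fun x => ∑ y, ∫⁻ s, ENNReal.ofReal (Real.exp (κ * ‖s‖))
      ∂(edgeKernel P q x y)) (fun _ _ => zero_le) (Finset.mem_univ x))

variable [∀ x y, IsProbabilityMeasure (q x y)]

theorem sum_stepPow_edgeKernel_univ (hP : ∀ x y, 0 ≤ P x y) (hP1 : ∀ x, ∑ y, P x y = 1)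
    (n : ℕ) (a : S) : ∑ b, stepPow (edgeKernel P q) n a b Set.univ = 1 := by
  simp only [stepPow_edgeKernel_univ]
  induction n with
  | zero => simp [Matrix.one_apply]
  | succ n ih =>
    simp only [pow_succ, Matrix.mul_apply]
    rw [Finset.sum_comm]
    simp only [← Finset.mul_sum, Matrix.of_apply, ← ENNReal.ofReal_sum_of_nonneg fun y _ => hP _ y,
      hP1, ENNReal.ofReal_one, mul_one, ih]

theorem exists_stepPow_edgeKernel_ne_zero (hP : ∀ x y, 0 ≤ P x y)
    (hirr : ∀ x y : S, ∃ n : ℕ, 0 < ((Matrix.of P) ^ n) x y) (a o : S) :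
    ∃ n, stepPow (edgeKernel P q) n a o ≠ 0 := by
  obtain ⟨n, hn⟩ := hirr a o
  refine ⟨n, fun h => ?_⟩
  refine Matrix_pow_apply_ne_zero (M := Matrix.of fun x y => ENNReal.ofReal (P x y)) hP
    (fun x y hxy => by simpa using hxy) n a o hn ?_
  rw [← stepPow_edgeKernel_univ (q := q), h]
  simp

theorem mem_loopEpigraph_of_rateI_le (hP : ∀ x y, 0 ≤ P x y) (hP1 : ∀ x, ∑ y, P x y = 1)
    (hirr : ∀ x y : S, ∃ n : ℕ, 0 < ((Matrix.of P) ^ n) x y) (hq : ∀ x y, ExpMoments (q x y))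
    (o : S) {z : (S × S → (Fin d → ℝ)) × (S × S → ℝ)} {c : ℝ}
    (hz : rateI P q z.1 z.2 ≤ (c : EReal)) : (z, c) ∈ loopEpigraph (edgeKernel P q) o := by
  have hsimp : z.2 ∈ stdSimplex ℝ (S × S) := by
    by_contra hz'
    rw [rateI_eq_top hz'] at hz
    exact absurd hz (not_le.2 (EReal.coe_lt_top c))
  refine mem_loopEpigraph_of_dual _ (exists_lintegral_exp_norm_edgeKernel_le hq) o (fun n => ?_)
    z c ?_
  · rw [← sum_stepPow_edgeKernel_univ (q := q) hP hP1 n o]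
    exact Finset.single_le_sum (f := fun b => stepPow (edgeKernel P q) n o b Set.univ)
      (fun _ _ => zero_le) (Finset.mem_univ o)
  rintro f γ ⟨C, hC, hbound⟩
  obtain ⟨l, u, hf⟩ := exists_eq_linForm f
  simp only [hf] at hbound ⊢
  refine le_of_forall_pos_le_add fun ε hε => ?_
  simp only [lintegral_exp_linForm_stepPow, lintegral_exp_linForm_edgeKernel hP hq] at hbound
  set M : Matrix S S ℝ≥0∞ := Matrix.of fun x y =>
    ENNReal.ofReal (P x y * Real.exp (realLogMGF (q x y) (l (x, y)) + u (x, y))) with hM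
  obtain ⟨v, hv, hvM⟩ := exists_subinvariant_vector M o (fun x y => by
    obtain ⟨n, hn⟩ := hirr x y
    refine ⟨n, Matrix_pow_apply_ne_zero hP (fun x y (hxy : 0 < P x y) => ?_) n x y hn⟩
    rw [hM, Matrix.of_apply, Ne, ENNReal.ofReal_eq_zero, not_le]
    positivity) hC (lt_add_of_pos_right γ hε) hbound
  set w : S × S → ℝ := fun p => realLogMGF (q p.1 p.2) (l p) + u p + Real.log (v p.2) -
    Real.log (v p.1) - (γ + ε) with hw
  have hsub : ∀ x, ∑ y, P x y * (Real.exp (w (x, y)) - 1) ≤ 0 := by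
    intro x
    have h1 := hvM x
    simp only [hM, Matrix.of_apply] at h1
    have h2 : ∀ y, 0 ≤ P x y * Real.exp (realLogMGF (q x y) (l (x, y)) + u (x, y)) := fun y =>
      mul_nonneg (hP x y) (Real.exp_pos _).le
    simp only [← ENNReal.ofReal_mul (h2 _)] at h1
    rw [← ENNReal.ofReal_sum_of_nonneg fun y _ => mul_nonneg (h2 y) (hv y).le,
      ENNReal.ofReal_le_ofReal_iff (mul_pos (Real.exp_pos _) (hv x)).le] at h1
    have h3 : ∀ y, P x y * Real.exp (w (x, y)) =
        P x y * Real.exp (realLogMGF (q x y) (l (x, y)) + u (x, y)) * v y *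
          (Real.exp (γ + ε) * v x)⁻¹ := by
      intro y
      simp only [hw]
      rw [Real.exp_sub, Real.exp_sub, Real.exp_add (_ + _), Real.exp_log (hv y),
        Real.exp_log (hv x)]
      field_simp
    simp only [mul_sub, Finset.sum_sub_distrib, mul_one, hP1, h3, ← Finset.sum_mul]
    rw [sub_nonpos, ← div_eq_mul_inv]
    exact (div_le_one (mul_pos (Real.exp_pos _) (hv x))).2 h1
  have hle := EReal.coe_le_coe_iff.1
    ((linForm_tiltPot_le_rateI hq l w (fun x => -Real.log (v x)) z).trans hz)
  have hsum : linForm l u z - (γ + ε) ≤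
      linForm l (tiltPot P q l w (fun x => -Real.log (v x))) z := by
    have h1 : linForm l u z - (γ + ε) =
        ∑ p, (dotp (l p) (z.1 p) + u p * z.2 p - (γ + ε) * z.2 p) := by
      rw [Finset.sum_sub_distrib, ← Finset.mul_sum, hsimp.2, mul_one]
      rfl
    rw [h1]
    refine Finset.sum_le_sum fun p _ => ?_
    have h2 := mul_nonneg (hsimp.1 p) (neg_nonneg.2 (hsub p.1))
    have h3 : tiltPot P q l w (fun x => -Real.log (v x)) p =
        u p - (γ + ε) - ∑ y, P p.1 y * (Real.exp (w (p.1, y)) - 1) := by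
      simp only [tiltPot]
      rw [show w p = _ from rfl]
      ring
    rw [h3]
    nlinarith
  linarith

end LoopRate

section EmpiricalPair

variable {Ω S : Type*} [DecidableEq S] {d : ℕ}

/-- The unnormalised pair `(n K^n, n Θ^n)`. -/
def edgeSum (X : ℕ → Ω → S) (A : ℕ → Ω → (Fin d → ℝ)) (n : ℕ) (ω : Ω) :
    (S × S → (Fin d → ℝ)) × (S × S → ℝ) :=
  ∑ m ∈ Finset.Icc 1 n, edgeIncr (X (m - 1) ω) (X m ω) (A m ω)

theorem Kn_Thetan_eq (X : ℕ → Ω → S) (A : ℕ → Ω → (Fin d → ℝ)) (n : ℕ) (ω : Ω) :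
    (Kn X A n ω, Thetan X n ω) = (n : ℝ)⁻¹ • edgeSum X A n ω := by
  refine Prod.ext ?_ ?_
  · funext p
    simp only [Kn, edgeSum, edgeIncr, Prod.smul_fst, Prod.fst_sum, Pi.smul_apply,
      Finset.sum_apply, Pi.single_apply, one_div, eq_comm]
  · funext p
    simp only [Thetan, edgeSum, edgeIncr, Prod.smul_snd, Prod.snd_sum, Pi.smul_apply,
      Finset.sum_apply, Pi.single_apply, one_div, eq_comm, smul_eq_mul]

theorem Thetan_mem_stdSimplex [Fintype S] (X : ℕ → Ω → S) {n : ℕ} (hn : n ≠ 0) (ω : Ω) :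
    Thetan X n ω ∈ stdSimplex ℝ (S × S) := by
  refine ⟨fun p => mul_nonneg (by positivity) (Finset.sum_nonneg fun m _ => ?_), ?_⟩
  · split_ifs <;> simp
  · simp only [Thetan, ← Finset.mul_sum]
    rw [Finset.sum_comm]
    refine (congrArg _ (Finset.sum_congr rfl fun m _ => (Finset.sum_eq_single
      (X (m - 1) ω, X m ω) (fun p _ hp => if_neg hp.symm)
      (fun hp => absurd (Finset.mem_univ _) hp)).trans (if_pos rfl))).trans ?_
    simp [hn]

variable [MeasurableSpace Ω] [Fintype S] {μ : Measure Ω} [IsProbabilityMeasure μ]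
  {P : S → S → ℝ} {q : S → S → Measure (Fin d → ℝ)}

theorem neg_rateI_le_liminf [∀ x y, IsProbabilityMeasure (q x y)]
    {X : ℕ → Ω → S} {A : ℕ → Ω → (Fin d → ℝ)}
    (hP : ∀ x y, 0 ≤ P x y) (hP1 : ∀ x, ∑ y, P x y = 1)
    (hirr : ∀ x y : S, ∃ n : ℕ, 0 < ((Matrix.of P) ^ n) x y) (hq : ∀ x y, ExpMoments (q x y))
    (hlaw : ∀ (n : ℕ) (a b : S) {D : Set ((S × S → (Fin d → ℝ)) × (S × S → ℝ))},
      MeasurableSet D → μ ({ω | X 0 ω = a ∧ X n ω = b} ∩ {ω | edgeSum X A n ω ∈ D}) =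
        μ {ω | X 0 ω = a} * stepPow (edgeKernel P q) n a b D)
    {G : Set ((S × S → (Fin d → ℝ)) × (S × S → ℝ))} (hG : IsOpen G)
    {z : (S × S → (Fin d → ℝ)) × (S × S → ℝ)} (hz : z ∈ G) :
    -rateI P q z.1 z.2 ≤ liminf (fun n : ℕ => (((n : ℝ)⁻¹ : ℝ) : EReal) *
      ENNReal.log (μ {ω | (Kn X A n ω, Thetan X n ω) ∈ G})) atTop := by
  rcases eq_or_ne (rateI P q z.1 z.2) ⊤ with htop | htop
  · rw [htop]
    exact bot_le
  have h0 := rateI_nonneg (P := P) hq z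
  have hbot : rateI P q z.1 z.2 ≠ ⊥ := (lt_of_lt_of_le EReal.bot_lt_zero h0).ne'
  lift rateI P q z.1 z.2 to ℝ using ⟨htop, hbot⟩ with c hc
  obtain ⟨a, ha⟩ : ∃ a, μ {ω | X 0 ω = a} ≠ 0 := by
    by_contra! hall
    have h1 : μ Set.univ ≤ ∑ a, μ {ω | X 0 ω = a} := by
      refine (measure_mono fun ω _ => ?_).trans (measure_biUnion_finset_le Finset.univ _)
      simp only [Set.mem_iUnion]
      exact ⟨X 0 ω, Finset.mem_univ _, rfl⟩
    simp [hall] at h1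
  obtain ⟨ρ, hρ, hball⟩ := Metric.isOpen_iff.1 hG z hz
  have hmem := mem_loopEpigraph_of_rateI_le hP hP1 hirr hq a hc.ge
  have key : ∀ ε : ℝ, 0 < ε → ε ≤ ρ → ((-(c + ε) : ℝ) : EReal) ≤
      liminf (fun n : ℕ => (((n : ℝ)⁻¹ : ℝ) : EReal) *
        ENNReal.log (μ {ω | (Kn X A n ω, Thetan X n ω) ∈ G})) atTop := by
    intro ε hε hερ
    obtain ⟨δ, hδ, hev⟩ := exists_eventually_le_stepPow (edgeKernel P q) (a := a) hmem
      (EReal.coe_nonneg.1 h0) (exists_stepPow_edgeKernel_ne_zero hP hirr a a) (fun i => by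
        by_contra! hall
        have h1 := sum_stepPow_edgeKernel_univ (q := q) hP hP1 i a
        simp [hall] at h1) hε
    refine le_liminf_inv_mul_log (mul_ne_zero ha hδ) ?_
    filter_upwards [hev, eventually_gt_atTop 0] with n hn hn0
    obtain ⟨b, hb⟩ := hn
    rw [mul_assoc]
    refine (mul_le_mul_right hb _).trans ?_
    rw [← hlaw n a b Metric.isOpen_ball.measurableSet]
    refine measure_mono fun ω hω => hball ?_
    have hn' : (0 : ℝ) < n := Nat.cast_pos.2 hn0
    have h2 : edgeSum X A n ω ∈ Metric.ball ((n : ℝ) • z) (n * ε) := hω.2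
    rw [Metric.mem_ball, dist_eq_norm] at h2 ⊢
    rw [Kn_Thetan_eq]
    have h3 : (n : ℝ)⁻¹ • edgeSum X A n ω - z = (n : ℝ)⁻¹ • (edgeSum X A n ω - (n : ℝ) • z) := by
      rw [smul_sub, smul_smul, inv_mul_cancel₀ hn'.ne', one_smul]
    rw [h3, norm_smul, norm_inv, Real.norm_natCast, inv_mul_lt_iff₀ hn']
    exact h2.trans_le (mul_le_mul_of_nonneg_left hερ hn'.le)
  refine EReal.ge_of_forall_gt_iff_ge.1 fun r hr => ?_
  rw [← EReal.coe_neg, EReal.coe_lt_coe_iff] at hr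
  refine le_trans (EReal.coe_le_coe_iff.2 ?_) (key (min ρ (-c - r)) (lt_min hρ (by linarith))
    (min_le_left _ _))
  linarith [min_le_right ρ (-c - r)]

variable [MeasurableSpace S] [MeasurableSingletonClass S]

theorem measurable_edgeIncr_process {X : ℕ → Ω → S} (hX : ∀ m, Measurable (X m))
    {A : ℕ → Ω → (Fin d → ℝ)} (hA : ∀ m, Measurable (A m)) (m : ℕ) :
    Measurable fun ω => edgeIncr (X (m - 1) ω) (X m ω) (A m ω) := by
  have h : Measurable fun r : (Fin d → ℝ) × (S × S) => edgeIncr r.2.1 r.2.2 r.1 :=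
    measurable_from_prod_countable_left fun p => measurable_edgeIncr p.1 p.2
  exact h.comp ((hA m).prodMk ((hX (m - 1)).prodMk (hX m)))

theorem measurable_edgeSum {X : ℕ → Ω → S} (hX : ∀ m, Measurable (X m))
    {A : ℕ → Ω → (Fin d → ℝ)} (hA : ∀ m, Measurable (A m)) (n : ℕ) :
    Measurable (edgeSum X A n) :=
  Finset.measurable_fun_sum _ fun m _ => measurable_edgeIncr_process hX hA m

variable {X : ℕ → Ω → S} {A : ℕ → Ω → (Fin d → ℝ)}

/-- The joint law of the end points and of the unnormalised pair `(n K^n, n Θ^n)`. -/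
theorem measure_edgeSum [∀ x y, IsProbabilityMeasure (q x y)]
    (hX : ∀ m, Measurable (X m)) (hA : ∀ m, Measurable (A m))
    (hMarkov : ∀ (n : ℕ) (x : ℕ → S),
      μ (⋂ m ∈ Finset.range (n + 1), {ω | X m ω = x m}) =
        μ {ω | X 0 ω = x 0} * ∏ m ∈ Finset.Icc 1 n, ENNReal.ofReal (P (x (m - 1)) (x m)))
    (hcondindep : ∀ n : ℕ, 1 ≤ n → ∀ (x : ℕ → S) (B : ℕ → Set (Fin d → ℝ)),
      (∀ m, MeasurableSet (B m)) →
      μ (⋂ m ∈ Finset.range (n + 1), {ω | X m ω = x m}) ≠ 0 →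
      (μ[|⋂ m ∈ Finset.range (n + 1), {ω | X m ω = x m}])
          (⋂ m ∈ Finset.Icc 1 n, {ω | A m ω ∈ B m}) =
        ∏ m ∈ Finset.Icc 1 n, q (x (m - 1)) (x m) (B m))
    (n : ℕ) (a b : S) {D : Set ((S × S → (Fin d → ℝ)) × (S × S → ℝ))} (hD : MeasurableSet D) :
    μ ({ω | X 0 ω = a ∧ X n ω = b} ∩ {ω | edgeSum X A n ω ∈ D}) =
      μ {ω | X 0 ω = a} * stepPow (edgeKernel P q) n a b D := by
  refine measure_sum_increments (edgeKernel P q) hX (measurable_edgeIncr_process hX hA) n μ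
    (fun u _ => μ {ω | X 0 ω = u}) (fun _ _ => measure_ne_top _ _) (fun x B hB => ?_) a b hD
  set H : Set Ω := ⋂ m ∈ Finset.range (n + 1), {ω | X m ω = x m} with hH
  have hHm : MeasurableSet H :=
    Finset.measurableSet_biInter _ fun m _ => hX m (measurableSet_singleton _)
  have hset : H ∩ ⋂ m ∈ Finset.Icc 1 n,
      (fun ω => edgeIncr (X (m - 1) ω) (X m ω) (A m ω)) ⁻¹' B m =
      H ∩ ⋂ m ∈ Finset.Icc 1 n, {ω | A m ω ∈ edgeIncr (x (m - 1)) (x m) ⁻¹' B m} := by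
    ext ω
    simp only [hH, Set.mem_inter_iff, Set.mem_iInter, Finset.mem_range, Finset.mem_Icc,
      Set.mem_preimage, Set.mem_ofPred_eq]
    refine and_congr_right fun h => forall₂_congr fun m hm => ?_
    rw [h (m - 1) (by omega), h m (by omega)]
  rw [hset]
  rcases Nat.eq_zero_or_pos n with rfl | hn
  · simp [hH]
  simp only [edgeKernel_apply _ _ (hB _), Finset.prod_mul_distrib]
  rw [← mul_assoc, ← hMarkov n x]
  by_cases h0 : μ H = 0
  · rw [h0, zero_mul]
    exact measure_inter_null_of_null_left _ h0
  · rw [← cond_mul_eq_inter hHm, mul_comm, hcondindep n hn x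
      (fun m => edgeIncr (x (m - 1)) (x m) ⁻¹' B m)
      (fun m => measurable_edgeIncr _ _ (hB m)) h0]

theorem map_edgeSum_le (hX : ∀ m, Measurable (X m)) (hA : ∀ m, Measurable (A m)) {n : ℕ}
    (hlaw : ∀ (a b : S) {D : Set ((S × S → (Fin d → ℝ)) × (S × S → ℝ))}, MeasurableSet D →
      μ ({ω | X 0 ω = a ∧ X n ω = b} ∩ {ω | edgeSum X A n ω ∈ D}) =
        μ {ω | X 0 ω = a} * stepPow (edgeKernel P q) n a b D) :
    μ.map (edgeSum X A n) ≤ ∑ a, ∑ b, stepPow (edgeKernel P q) n a b := by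
  refine Measure.le_iff.2 fun D hD => ?_
  rw [Measure.map_apply (measurable_edgeSum hX hA n) hD]
  have hsub : edgeSum X A n ⁻¹' D ⊆ ⋃ a ∈ (Finset.univ : Finset S), ⋃ b ∈ (Finset.univ : Finset S),
      {ω | X 0 ω = a ∧ X n ω = b} ∩ {ω | edgeSum X A n ω ∈ D} := by
    intro ω hω
    simp only [Set.mem_iUnion]
    exact ⟨X 0 ω, Finset.mem_univ _, X n ω, Finset.mem_univ _, ⟨rfl, rfl⟩, hω⟩
  refine (measure_mono hsub).trans ((measure_biUnion_finset_le _ _).trans ?_)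
  rw [Measure.finsetSum_apply]
  refine Finset.sum_le_sum fun a _ => (measure_biUnion_finset_le _ _).trans ?_
  rw [Measure.finsetSum_apply]
  refine Finset.sum_le_sum fun b _ => ?_
  rw [hlaw a b hD]
  exact mul_le_of_le_one_left' prob_le_one

end EmpiricalPair

/-- **Theorem 1 (discrete-time LDP).** Under conditional independence of the increments
given the chain and superlinear growth of the conjugates, the pair `(K^n, Θ^n)` satisfies
the large-deviation principle with speed `n` and good rate functional `I`. -/
theorem discrete_time_joint_LDP
    {Ω : Type*} [MeasurableSpace Ω] (μ : Measure Ω) [IsProbabilityMeasure μ]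
    {𝒳 : Type*} [Fintype 𝒳] [DecidableEq 𝒳] [Nonempty 𝒳] [MeasurableSpace 𝒳]
    [MeasurableSingletonClass 𝒳] {d : ℕ} (hd : 1 ≤ d)
    (X : ℕ → Ω → 𝒳) (hX : ∀ m, Measurable (X m))
    (A : ℕ → Ω → (Fin d → ℝ)) (hA : ∀ m, Measurable (A m))
    (P : 𝒳 → 𝒳 → ℝ) (hPnonneg : ∀ x y, 0 ≤ P x y) (hProw : ∀ x, ∑ y, P x y = 1)
    (hirr : ∀ x y : 𝒳, ∃ n : ℕ, 0 < ((Matrix.of P) ^ n) x y)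
    (hMarkov : ∀ (n : ℕ) (x : ℕ → 𝒳),
      μ (⋂ m ∈ Finset.range (n + 1), {ω | X m ω = x m}) =
        μ {ω | X 0 ω = x 0} * ∏ m ∈ Finset.Icc 1 n, ENNReal.ofReal (P (x (m - 1)) (x m)))
    (q : 𝒳 → 𝒳 → Measure (Fin d → ℝ)) (hq : ∀ x y, IsProbabilityMeasure (q x y))
    (hqdef : ∀ x y : 𝒳, μ ({ω | X 0 ω = x} ∩ {ω | X 1 ω = y}) ≠ 0 →
      ∀ B : Set (Fin d → ℝ), MeasurableSet B →
        q x y B = (μ[|{ω | X 0 ω = x} ∩ {ω | X 1 ω = y}]) {ω | A 1 ω ∈ B})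
    (hcondindep : ∀ n : ℕ, 1 ≤ n → ∀ (x : ℕ → 𝒳) (B : ℕ → Set (Fin d → ℝ)),
      (∀ m, MeasurableSet (B m)) →
      μ (⋂ m ∈ Finset.range (n + 1), {ω | X m ω = x m}) ≠ 0 →
      (μ[|⋂ m ∈ Finset.range (n + 1), {ω | X m ω = x m}])
          (⋂ m ∈ Finset.Icc 1 n, {ω | A m ω ∈ B m}) =
        ∏ m ∈ Finset.Icc 1 n, q (x (m - 1)) (x m) (B m))
    (hsl : ∀ x y : 𝒳, Superlinear (q x y)) :
    LowerSemicontinuous (fun kθ : (𝒳 × 𝒳 → (Fin d → ℝ)) × (𝒳 × 𝒳 → ℝ) =>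
      rateI P q kθ.1 kθ.2) ∧
    (∀ c : ℝ, IsCompact {kθ : (𝒳 × 𝒳 → (Fin d → ℝ)) × (𝒳 × 𝒳 → ℝ) |
      rateI P q kθ.1 kθ.2 ≤ (c : EReal)}) ∧
    (∀ F : Set ((𝒳 × 𝒳 → (Fin d → ℝ)) × (𝒳 × 𝒳 → ℝ)), IsClosed F →
      Filter.limsup (fun n : ℕ => (((n : ℝ)⁻¹ : ℝ) : EReal) * ENNReal.log
          (μ {ω | (Kn X A n ω, Thetan X n ω) ∈ F})) Filter.atTop ≤
        -(⨅ kθ ∈ F, rateI P q kθ.1 kθ.2)) ∧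
    (∀ G : Set ((𝒳 × 𝒳 → (Fin d → ℝ)) × (𝒳 × 𝒳 → ℝ)), IsOpen G →
      -(⨅ kθ ∈ G, rateI P q kθ.1 kθ.2) ≤
        Filter.liminf (fun n : ℕ => (((n : ℝ)⁻¹ : ℝ) : EReal) * ENNReal.log
          (μ {ω | (Kn X A n ω, Thetan X n ω) ∈ G})) Filter.atTop) := by
  have : ∀ x y, IsProbabilityMeasure (q x y) := hq
  have hexp : ∀ x y, ExpMoments (q x y) := fun x y s => (hsl x y).lintegral_exp_ne_top s
  have hlaw := measure_edgeSum hX hA hMarkov hcondindep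
  refine ⟨lowerSemicontinuous_rateI hPnonneg hexp, isCompact_rateI_le hPnonneg hexp,
    fun F hF => ?_, fun G hG => ?_⟩
  · refine limsup_le_neg_iInf_rateI hPnonneg hexp μ (fun n ω => (Kn X A n ω, Thetan X n ω))
      (fun n => ?_) (fun n hn ω => Thetan_mem_stdSimplex X hn ω) (fun t => ?_) hF
    · rw [funext fun ω => Kn_Thetan_eq X A n ω]
      exact (measurable_edgeSum hX hA n).const_smul (n : ℝ)⁻¹
    · refine ⟨∑ a, ∑ b, ENNReal.ofReal (Real.exp (t.2.2 b - t.2.2 a)), by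
        simp [ENNReal.sum_eq_top], fun n hn => ?_⟩
      have hn' : (n : ℝ) ≠ 0 := Nat.cast_ne_zero.2 hn
      have hscale : ∀ ω, n * tilt P q t (Kn X A n ω, Thetan X n ω) =
          tilt P q t (edgeSum X A n ω) := fun ω => by
        rw [Kn_Thetan_eq, tilt, linForm_smul, mul_inv_cancel_left₀ hn', tilt]
      have hmeas : Measurable fun s => ENNReal.ofReal (Real.exp (tilt P q t s)) :=
        (Real.continuous_exp.comp (continuous_tilt t)).measurable.ennreal_ofReal
      simp only [hscale]
      rw [← lintegral_map hmeas (measurable_edgeSum hX hA n)]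
      refine (lintegral_mono' (map_edgeSum_le hX hA (hlaw n)) le_rfl).trans ?_
      simp only [lintegral_finsetSum_measure]
      exact Finset.sum_le_sum fun a _ => Finset.sum_le_sum fun b _ =>
        lintegral_exp_tilt_stepPow_le hPnonneg hProw hexp t n a b
  · exact EReal.neg_le_of_neg_le (le_iInf₂ fun z hz => EReal.neg_le_of_neg_le
      (neg_rateI_le_liminf hPnonneg hProw hirr hexp hlaw hG hz))
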